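/- arXiv:1905.07873 — 3 statements merged into one kernel-verified Lean document; each statement's English description precedes it below -/
import Mathlib

section
/- Let C_i be a cable line from S_i to T_i and C_j a cable line from S_j to T_j in the plane ℝ², with C_i and C_j disjoint. Let Π_i (respectively Π_j) denote the cable polygon of C_i (respectively C_j), each assumed to be a Jordan curve. If S_i and T_i are both exterior to Π_j, and S_j and T_j are both exterior to Π_i, then the closed straight-line segments [S_i, T_i] and [S_j, T_j] do not intersect. -/
open Set

noncomputable section

/-- The Euclidean plane ℝ². -/
abbrev Plane := EuclideanSpace ℝ (Fin 2)

/-- A cable line from `S` to `T`: a polygonal chain (union of closed segments through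
consecutive points) whose first point is `S` and whose last point is `T`. -/
def IsCableLine (S T : Plane) (C : Set Plane) : Prop :=
  ∃ (m : ℕ) (p : ℕ → Plane), p 0 = S ∧ p m = T ∧
    C = ⋃ k ∈ Finset.range m, segment ℝ (p k) (p (k + 1))

/-- A Jordan curve (simple closed curve): the range of a continuous injective map
from the circle `AddCircle 1`. -/
def IsJordanCurve (Γ : Set Plane) : Prop :=
  ∃ f : AddCircle (1 : ℝ) → Plane, Continuous f ∧ Function.Injective f ∧ Set.range f = Γ

/-- The interior of a closed curve `Γ`: the union of the bounded connected components
of the complement of `Γ`. -/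
def curveInterior (Γ : Set Plane) : Set Plane :=
  {x | x ∉ Γ ∧ Bornology.IsBounded (connectedComponentIn Γᶜ x)}

/-- A point is exterior to `Γ` if it lies in an unbounded connected component of the
complement of `Γ` (in particular it does not lie on `Γ`). -/
def IsExteriorTo (x : Plane) (Γ : Set Plane) : Prop :=
  x ∉ Γ ∧ ¬ Bornology.IsBounded (connectedComponentIn Γᶜ x)

/-- The signed angle in `(-π, π]` under which the oriented segment from `a` to `b` is seen
from `x`. -/
def subtendedAngle (a b x : ℂ) : ℝ := Complex.arg ((b - x) / (a - x))

/-- The total signed angle under which the chain `p 0, …, p m` is seen from `x`. -/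
def chainAngle (p : ℕ → ℂ) (m : ℕ) (x : ℂ) : ℝ :=
  ∑ k ∈ Finset.range m, subtendedAngle (p k) (p (k + 1)) x

/-- The total signed angle under which the closed chain `p 0, …, p m, p 0` is seen from `x`. -/
def closedChainAngle (p : ℕ → ℂ) (m : ℕ) (x : ℂ) : ℝ :=
  chainAngle p m x + subtendedAngle (p m) (p 0) x

theorem sub_div_sub_mem_slitPlane {a b x : ℂ} (hx : x ∉ segment ℝ a b) :
    (b - x) / (a - x) ∈ Complex.slitPlane := by
  have ha : a - x ≠ 0 := fun h ↦ hx (sub_eq_zero.1 h ▸ left_mem_segment ℝ a b)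
  by_contra h
  rw [Complex.mem_slitPlane_iff, not_or, not_lt, not_not] at h
  obtain ⟨hre, him⟩ := h
  obtain ⟨r, hr⟩ : ∃ r : ℝ, r = -((b - x) / (a - x)).re := ⟨_, rfl⟩
  have hr0 : 0 ≤ r := by linarith
  have hz : (b - x) / (a - x) = -(r : ℂ) := by
    apply Complex.ext <;> simp [hr, him]
  rw [div_eq_iff ha] at hz
  apply hx
  have h1 : (1 + r) ≠ 0 := by positivity
  have h2 : (1 + (r : ℂ)) ≠ 0 := by exact_mod_cast h1
  refine ⟨r / (1 + r), 1 / (1 + r), by positivity, by positivity, by field_simp; ring, ?_⟩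
  simp only [Complex.real_smul]
  push_cast
  field_simp
  linear_combination hz

theorem continuousAt_subtendedAngle {a b x : ℂ} (hx : x ∉ segment ℝ a b) :
    ContinuousAt (subtendedAngle a b) x := by
  have ha : a - x ≠ 0 := fun h ↦ hx (sub_eq_zero.1 h ▸ left_mem_segment ℝ a b)
  refine ContinuousAt.comp (g := Complex.arg) (f := fun x ↦ (b - x) / (a - x))
    (Complex.continuousAt_arg (sub_div_sub_mem_slitPlane hx)) ?_
  exact ContinuousAt.div (by fun_prop) (by fun_prop) ha

theorem tendsto_subtendedAngle_cobounded (a b : ℂ) :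
    Filter.Tendsto (subtendedAngle a b) (Bornology.cobounded ℂ) (nhds 0) := by
  have h1 : Filter.Tendsto (fun x : ℂ ↦ a - x) (Bornology.cobounded ℂ)
      (Bornology.cobounded ℂ) := tendsto_const_sub_cobounded a
  have h2 : Filter.Tendsto (fun x : ℂ ↦ 1 + (b - a) * (a - x)⁻¹) (Bornology.cobounded ℂ)
      (nhds (1 + (b - a) * 0)) :=
    ((Filter.tendsto_inv₀_cobounded.comp h1).const_mul (b - a)).const_add 1
  rw [mul_zero, add_zero] at h2
  have h3 : Filter.Tendsto (fun x : ℂ ↦ (b - x) / (a - x)) (Bornology.cobounded ℂ)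
      (nhds 1) := by
    refine h2.congr' ?_
    filter_upwards [Bornology.eventually_ne_cobounded a] with x hx
    have : a - x ≠ 0 := sub_ne_zero.2 hx.symm
    field_simp
    ring
  have h4 := (Complex.continuousAt_arg Complex.one_mem_slitPlane).tendsto.comp h3
  rwa [Complex.arg_one] at h4

theorem coe_closedChainAngle {p : ℕ → ℂ} {m : ℕ} {x : ℂ} (hm : p m ≠ x)
    (hp : ∀ k < m, p k ≠ x ∧ p (k + 1) ≠ x) (h0 : p 0 ≠ x) :
    ((closedChainAngle p m x : ℝ) : Real.Angle) = 0 := by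
  have key : ∀ {a b : ℂ}, a ≠ x → b ≠ x → ((subtendedAngle a b x : ℝ) : Real.Angle)
      = (Complex.arg (b - x) : Real.Angle) - (Complex.arg (a - x) : Real.Angle) :=
    fun ha hb ↦ Complex.arg_div_coe_angle (sub_ne_zero.2 hb) (sub_ne_zero.2 ha)
  have hsum : ((chainAngle p m x : ℝ) : Real.Angle)
      = (Complex.arg (p m - x) : Real.Angle) - (Complex.arg (p 0 - x) : Real.Angle) := by
    rw [← Finset.sum_range_sub (fun k ↦ (Complex.arg (p k - x) : Real.Angle)) m, chainAngle,
      ← Real.Angle.coe_coeHom, map_sum]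
    refine Finset.sum_congr rfl fun k hk ↦ ?_
    have := hp k (Finset.mem_range.1 hk)
    exact key this.1 this.2
  rw [closedChainAngle, Real.Angle.coe_add, hsum, key hm h0]
  abel

/-- The closed chain angle vanishes on the unbounded components of the complement. -/
theorem closedChainAngle_eq_zero {p : ℕ → ℂ} {m : ℕ} {U : Set ℂ} (hU : IsPreconnected U)
    (hb : ¬ Bornology.IsBounded U) (hseg : ∀ k < m, Disjoint U (segment ℝ (p k) (p (k + 1))))
    (hclose : Disjoint U (segment ℝ (p m) (p 0))) {x : ℂ} (hx : x ∈ U) :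
    closedChainAngle p m x = 0 := by
  have hcont : ContinuousOn (closedChainAngle p m) U := by
    intro y hy
    refine ContinuousAt.continuousWithinAt (ContinuousAt.add (tendsto_finsetSum _ fun k hk ↦ ?_)
      (continuousAt_subtendedAngle (disjoint_left.1 hclose hy)))
    exact continuousAt_subtendedAngle
      (disjoint_left.1 (hseg k (Finset.mem_range.1 hk)) hy)
  have hval : ∀ y ∈ U, ∃ n : ℤ, closedChainAngle p m y = 2 * Real.pi * n := by
    intro y hy
    have hne : ∀ {a b : ℂ}, Disjoint U (segment ℝ a b) → a ≠ y ∧ b ≠ y := fun h ↦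
      ⟨fun e ↦ disjoint_left.1 h hy (e ▸ left_mem_segment ℝ _ _),
        fun e ↦ disjoint_left.1 h hy (e ▸ right_mem_segment ℝ _ _)⟩
    have := coe_closedChainAngle (hne hclose).1 (fun k hk ↦ hne (hseg k hk)) (hne hclose).2
    rw [← Real.Angle.coe_zero, Real.Angle.angle_eq_iff_two_pi_dvd_sub] at this
    simpa using this
  have hlim : Filter.Tendsto (closedChainAngle p m) (Bornology.cobounded ℂ) (nhds 0) := by
    have := (tendsto_finsetSum (Finset.range m) fun k _ ↦
      tendsto_subtendedAngle_cobounded (p k) (p (k + 1))).add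
      (tendsto_subtendedAngle_cobounded (p m) (p 0))
    rwa [Finset.sum_const_zero, add_zero] at this
  obtain ⟨y, hyU, hy⟩ : ∃ y ∈ U, closedChainAngle p m y = 0 := by
    have hev : ∀ᶠ y in Bornology.cobounded ℂ, |closedChainAngle p m y| < 2 * Real.pi := by
      have := hlim.abs
      rw [abs_zero] at this
      exact this.eventually_lt_const Real.two_pi_pos
    by_contra! hcon
    refine hb (Bornology.isBounded_def.2 (Filter.mem_of_superset hev fun y hy hyU ↦ ?_))
    obtain ⟨n, hn⟩ := hval y hyU
    have hy' : |closedChainAngle p m y| < 2 * Real.pi := hy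
    rw [hn, abs_mul, abs_of_pos Real.two_pi_pos] at hy'
    have h1 : |(n : ℝ)| < 1 := by
      by_contra! h
      nlinarith [Real.two_pi_pos]
    have h2 : n = 0 := Int.abs_lt_one_iff.1 (by exact_mod_cast h1)
    exact hcon y hyU (by rw [hn, h2]; simp)
  obtain ⟨n, hn⟩ := hval x hx
  have hord := (hU.image _ hcont).ordConnected
  have hpi := Real.pi_pos
  have hnot : ∀ z ∈ U, ∀ j : ℤ, closedChainAngle p m z = Real.pi * (2 * j + 1) → False := by
    intro z hz j h
    obtain ⟨l, hl⟩ := hval z hz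
    have : (2 * l : ℝ) = 2 * j + 1 := by
      apply mul_left_cancel₀ hpi.ne'
      linarith
    have : 2 * l = 2 * j + 1 := by exact_mod_cast this
    omega
  rcases lt_trichotomy n 0 with h | h | h
  · have h1 : (n : ℝ) ≤ -1 := by exact_mod_cast Int.le_sub_one_of_lt h
    obtain ⟨z, hz, hzv⟩ := hord.out (mem_image_of_mem _ hx) (mem_image_of_mem _ hyU)
      (show -Real.pi ∈ _ from ⟨by rw [hn]; nlinarith, by rw [hy]; linarith⟩)
    exact (hnot z hz (-1) (by rw [hzv]; push_cast; ring)).elim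
  · rw [hn, h]; simp
  · have h1 : (1 : ℝ) ≤ n := by exact_mod_cast h
    obtain ⟨z, hz, hzv⟩ := hord.out (mem_image_of_mem _ hyU) (mem_image_of_mem _ hx)
      (show Real.pi ∈ _ from ⟨by rw [hy]; linarith, by rw [hn]; nlinarith⟩)
    exact (hnot z hz 0 (by rw [hzv]; push_cast; ring)).elim

theorem arg_div_of_re_pos {z w : ℂ} (hz : 0 < z.re) (hw : 0 < w.re) :
    Complex.arg (z / w) = Complex.arg z - Complex.arg w := by
  have hz0 : z ≠ 0 := by rintro rfl; simp at hz
  have hw0 : w ≠ 0 := by rintro rfl; simp at hw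
  have h1 := abs_lt.1 (Complex.abs_arg_lt_pi_div_two_iff.2 (Or.inl hz))
  have h2 := abs_lt.1 (Complex.abs_arg_lt_pi_div_two_iff.2 (Or.inl hw))
  have h := Complex.arg_div_coe_angle hz0 hw0
  rw [← Real.Angle.coe_sub] at h
  have h3 := congrArg Real.Angle.toReal h
  rwa [Complex.arg_coe_angle_toReal_eq_arg,
    Real.Angle.toReal_coe_eq_self_iff.2 ⟨by linarith, by linarith⟩] at h3

/-- For disjoint segments, the change of the angle subtended by one of them along the other is
symmetric in the two segments. -/
theorem subtendedAngle_sub_comm {p p' q q' : ℂ}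
    (h : Disjoint (segment ℝ p p') (segment ℝ q q')) :
    subtendedAngle q q' p' - subtendedAngle q q' p
      = subtendedAngle p p' q' - subtendedAngle p p' q := by
  have hcompact : ∀ a b : ℂ, IsCompact (segment ℝ a b) := fun a b ↦ by
    rw [segment_eq_image_lineMap]
    exact isCompact_Icc.image AffineMap.lineMap_continuous
  obtain ⟨f, u, v, hu, huv, hv⟩ := geometric_hahn_banach_compact_closed
    (convex_segment p p') (hcompact p p') (convex_segment q q') (hcompact q q').isClosed h
  obtain ⟨w, hw⟩ : ∃ w : ℂ, ∀ z, f z = (w * z).re := by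
    refine ⟨⟨f 1, -f Complex.I⟩, fun z ↦ ?_⟩
    have hz : z = z.re • (1 : ℂ) + z.im • Complex.I := by
      apply Complex.ext <;> simp
    conv_lhs => rw [hz]
    rw [map_add, map_smul, map_smul]
    simp [mul_comm]
  have hpos : ∀ a ∈ segment ℝ p p', ∀ b ∈ segment ℝ q q', 0 < (w * (b - a)).re := by
    intro a ha b hb
    rw [← hw, map_sub]
    linarith [hu a ha, hv b hb]
  have hw0 : w ≠ 0 := by
    rintro rfl
    simpa using hpos p (left_mem_segment ℝ _ _) q (left_mem_segment ℝ _ _)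
  have harg : ∀ a ∈ segment ℝ p p', ∀ b ∈ segment ℝ q q', ∀ a' ∈ segment ℝ p p',
      ∀ b' ∈ segment ℝ q q', Complex.arg ((b - a) / (b' - a'))
        = Complex.arg (w * (b - a)) - Complex.arg (w * (b' - a')) := by
    intro a ha b hb a' ha' b' hb'
    rw [← arg_div_of_re_pos (hpos a ha b hb) (hpos a' ha' b' hb'), mul_div_mul_left _ _ hw0]
  have hp := left_mem_segment ℝ p p'
  have hp' := right_mem_segment ℝ p p'
  have hq := left_mem_segment ℝ q q'
  have hq' := right_mem_segment ℝ q q'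
  have hneg : ∀ a b c : ℂ, (b - c) / (a - c) = (c - b) / (c - a) := fun a b c ↦ by
    rw [← neg_sub c b, ← neg_sub c a, neg_div_neg_eq]
  simp only [subtendedAngle]
  rw [hneg p p' q', hneg p p' q, harg _ hp' _ hq' _ hp' _ hq, harg _ hp _ hq' _ hp _ hq,
    harg _ hp' _ hq' _ hp _ hq', harg _ hp' _ hq _ hp _ hq]
  ring

/-- For disjoint chains, the change of the angle subtended by one of them along the other is
symmetric in the two chains. -/
theorem chainAngle_sub_comm {p q : ℕ → ℂ} {m n : ℕ}
    (h : ∀ k < m, ∀ l < n,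
      Disjoint (segment ℝ (p k) (p (k + 1))) (segment ℝ (q l) (q (l + 1)))) :
    chainAngle q n (p m) - chainAngle q n (p 0)
      = chainAngle p m (q n) - chainAngle p m (q 0) := by
  simp only [chainAngle]
  rw [← Finset.sum_sub_distrib, ← Finset.sum_sub_distrib]
  calc
    _ = ∑ l ∈ Finset.range n, ∑ k ∈ Finset.range m,
        (subtendedAngle (q l) (q (l + 1)) (p (k + 1)) - subtendedAngle (q l) (q (l + 1)) (p k)) :=
      Finset.sum_congr rfl fun l _ ↦
        (Finset.sum_range_sub (fun k ↦ subtendedAngle (q l) (q (l + 1)) (p k)) m).symm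
    _ = ∑ k ∈ Finset.range m, ∑ l ∈ Finset.range n,
        (subtendedAngle (p k) (p (k + 1)) (q (l + 1)) - subtendedAngle (p k) (p (k + 1)) (q l)) := by
      rw [Finset.sum_comm]
      exact Finset.sum_congr rfl fun k hk ↦ Finset.sum_congr rfl fun l hl ↦
        subtendedAngle_sub_comm (h k (Finset.mem_range.1 hk) l (Finset.mem_range.1 hl))
    _ = _ := Finset.sum_congr rfl fun k _ ↦
      Finset.sum_range_sub (fun l ↦ subtendedAngle (p k) (p (k + 1)) (q l)) n

theorem im_div_eq (z w : ℂ) :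
    (z / w).im = (w.re * z.im - w.im * z.re) / Complex.normSq w := by
  rw [Complex.div_im]
  ring

theorem subtendedAngle_pos {a b x : ℂ}
    (h : 0 < (a - x).re * (b - x).im - (a - x).im * (b - x).re) : 0 < subtendedAngle a b x := by
  have ha : a - x ≠ 0 := fun h0 ↦ by simp [h0] at h
  have him : 0 < ((b - x) / (a - x)).im := by
    rw [im_div_eq]
    exact div_pos h (Complex.normSq_pos.2 ha)
  refine lt_of_le_of_ne (Complex.arg_nonneg_iff.2 him.le) fun h0 ↦ ?_
  exact him.ne' (Complex.arg_eq_zero_iff.1 h0.symm).2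

theorem subtendedAngle_neg {a b x : ℂ}
    (h : (a - x).re * (b - x).im - (a - x).im * (b - x).re < 0) : subtendedAngle a b x < 0 := by
  have ha : a - x ≠ 0 := fun h0 ↦ by simp [h0] at h
  rw [subtendedAngle, Complex.arg_neg_iff, im_div_eq]
  exact div_neg_of_neg_of_pos h (Complex.normSq_pos.2 ha)

/-- Two intersecting parallel segments have an endpoint of one on the other. -/
theorem endpoint_mem_of_smul {E : Type*} [AddCommGroup E] [Module ℝ E] {x u : E} {s t r : ℝ}
    (hs0 : 0 ≤ s) (hs1 : s ≤ 1) (ht0 : 0 ≤ t) (ht1 : t ≤ 1) (hr : r ≠ 0) :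
    x + (1 - s) • u ∈ segment ℝ (x - t • r • u) (x + (1 - t) • r • u) ∨
      x - t • r • u ∈ segment ℝ (x - s • u) (x + (1 - s) • u) ∨
      x + (1 - t) • r • u ∈ segment ℝ (x - s • u) (x + (1 - s) • u) := by
  have key : ∀ {y v : E} {α β γ : ℝ}, α ≤ β → β ≤ γ →
      y + β • v ∈ segment ℝ (y + α • v) (y + γ • v) := by
    intro y v α β γ h1 h2
    rcases h1.eq_or_lt with rfl | h1
    · exact left_mem_segment ℝ _ _
    have h3 : γ - α ≠ 0 := by linarith
    refine ⟨(γ - β) / (γ - α), (β - α) / (γ - α), div_nonneg (by linarith) (by linarith),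
      div_nonneg (by linarith) (by linarith), by field_simp; ring, ?_⟩
    match_scalars <;> field_simp <;> ring
  have e1 : x - t • r • u = x + (-(t * r)) • u := by module
  have e2 : x + (1 - t) • r • u = x + ((1 - t) * r) • u := by module
  have e3 : x - s • u = x + (-s) • u := by module
  rw [e1, e2, e3]
  rcases lt_or_gt_of_ne hr with hr | hr
  · rcases le_total (-(t * r)) (1 - s) with h | h
    · exact Or.inr (Or.inl (key (by nlinarith) h))
    · rw [segment_symm ℝ (x + (-(t * r)) • u)]
      exact Or.inl (key (by nlinarith) h)
  · rcases le_total ((1 - t) * r) (1 - s) with h | h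
    · exact Or.inr (Or.inr (key (by nlinarith) h))
    · exact Or.inl (key (by nlinarith) h)

/-- Segments that intersect away from their endpoints subtend incompatible angles. -/
theorem disjoint_segment_of_subtendedAngle {a b c d : ℂ}
    (ha : a ∉ segment ℝ c d) (hb : b ∉ segment ℝ c d) (hc : c ∉ segment ℝ a b)
    (hd : d ∉ segment ℝ a b)
    (h : subtendedAngle d c a - subtendedAngle d c b
      = subtendedAngle b a c - subtendedAngle b a d) :
    Disjoint (segment ℝ a b) (segment ℝ c d) := by
  rw [disjoint_left]
  intro x hx hx'
  have hxa : x ≠ a := fun e ↦ ha (e ▸ hx')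
  have hxb : x ≠ b := fun e ↦ hb (e ▸ hx')
  have hxc : x ≠ c := fun e ↦ hc (e ▸ hx)
  have hxd : x ≠ d := fun e ↦ hd (e ▸ hx)
  rw [segment_eq_image'] at hx hx'
  obtain ⟨s, ⟨hs0, hs1⟩, hs⟩ := hx
  obtain ⟨t, ⟨ht0, ht1⟩, ht⟩ := hx'
  simp only at hs ht
  have hs0 : 0 < s := hs0.lt_of_ne (by rintro rfl; exact hxa (by simp [← hs]))
  have hs1 : s < 1 := hs1.lt_of_ne (by rintro rfl; exact hxb (by simp [← hs]))
  have ht0 : 0 < t := ht0.lt_of_ne (by rintro rfl; exact hxc (by simp [← ht]))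
  have ht1 : t < 1 := ht1.lt_of_ne (by rintro rfl; exact hxd (by simp [← ht]))
  obtain ⟨u, hu⟩ : ∃ u, u = b - a := ⟨_, rfl⟩
  obtain ⟨v, hv⟩ : ∃ v, v = d - c := ⟨_, rfl⟩
  rw [← hu] at hs
  rw [← hv] at ht
  have ea : a = x - s • u := by rw [← hs]; abel
  have eb : b = x + (1 - s) • u := by
    rw [← hs, sub_smul, one_smul, hu]; abel
  have ec : c = x - t • v := by rw [← ht]; abel
  have ed : d = x + (1 - t) • v := by
    rw [← ht, sub_smul, one_smul, hv]; abel
  have hs1' : 0 < 1 - s := sub_pos.2 hs1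
  have ht1' : 0 < 1 - t := sub_pos.2 ht1
  have hA : (d - b).re * (c - b).im - (d - b).im * (c - b).re
      = (1 - s) * (u.re * v.im - u.im * v.re) := by
    rw [eb, ec, ed]; simp; ring
  have hB : (d - a).re * (c - a).im - (d - a).im * (c - a).re
      = s * -(u.re * v.im - u.im * v.re) := by
    rw [ea, ec, ed]; simp; ring
  have hC : (b - d).re * (a - d).im - (b - d).im * (a - d).re
      = (1 - t) * -(u.re * v.im - u.im * v.re) := by
    rw [ea, eb, ed]; simp; ring
  have hD : (b - c).re * (a - c).im - (b - c).im * (a - c).re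
      = t * (u.re * v.im - u.im * v.re) := by
    rw [ea, eb, ec]; simp; ring
  rcases lt_trichotomy (u.re * v.im - u.im * v.re) 0 with hk | hk | hk
  · have h1 := subtendedAngle_neg (hA.trans_lt (mul_neg_of_pos_of_neg hs1' hk))
    have h2 := subtendedAngle_pos ((mul_pos hs0 (neg_pos.2 hk)).trans_eq hB.symm)
    have h3 := subtendedAngle_pos ((mul_pos ht1' (neg_pos.2 hk)).trans_eq hC.symm)
    have h4 := subtendedAngle_neg (hD.trans_lt (mul_neg_of_pos_of_neg ht0 hk))
    linarith
  · have hu0 : u ≠ 0 := by rintro rfl; exact hxa (by simp [ea])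
    have hv0 : v ≠ 0 := by rintro rfl; exact hxc (by simp [ec])
    obtain ⟨r, hr⟩ : ∃ r : ℝ, v = r • u := by
      have him : (v / u).im = 0 := by rw [im_div_eq, hk, zero_div]
      refine ⟨(v / u).re, ?_⟩
      rw [Complex.real_smul, ← div_eq_iff hu0]
      apply Complex.ext <;> simp [him]
    have hr0 : r ≠ 0 := by rintro rfl; exact hv0 (by simp [hr])
    rw [hr] at ec ed
    rcases endpoint_mem_of_smul (x := x) (u := u) hs0.le hs1.le ht0.le ht1.le hr0 with h | h | h
    · rw [← eb, ← ec, ← ed] at h; exact hb h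
    · rw [← ea, ← eb, ← ec] at h; exact hc h
    · rw [← ea, ← eb, ← ed] at h; exact hd h
  · have h1 := subtendedAngle_pos ((mul_pos hs1' hk).trans_eq hA.symm)
    have h2 := subtendedAngle_neg (hB.trans_lt (mul_neg_of_pos_of_neg hs0 (neg_neg_of_pos hk)))
    have h3 := subtendedAngle_neg (hC.trans_lt (mul_neg_of_pos_of_neg ht1' (neg_neg_of_pos hk)))
    have h4 := subtendedAngle_pos ((mul_pos ht0 hk).trans_eq hD.symm)
    linarith

/-- The standard isometry between the Euclidean plane and the complex plane. -/
def planeToComplex : Plane ≃ₗᵢ[ℝ] ℂ := Complex.orthonormalBasisOneI.repr.symm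

theorem planeToComplex_image_segment (a b : Plane) :
    planeToComplex '' segment ℝ a b = segment ℝ (planeToComplex a) (planeToComplex b) :=
  image_segment ℝ planeToComplex.toLinearEquiv.toLinearMap.toAffineMap a b

theorem disjoint_segment_planeToComplex {a b c d : Plane} :
    Disjoint (segment ℝ (planeToComplex a) (planeToComplex b))
      (segment ℝ (planeToComplex c) (planeToComplex d)) ↔
      Disjoint (segment ℝ a b) (segment ℝ c d) := by
  rw [← planeToComplex_image_segment, ← planeToComplex_image_segment,
    disjoint_image_iff planeToComplex.injective]

theorem planeToComplex_mem_segment {x a b : Plane} :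
    planeToComplex x ∈ segment ℝ (planeToComplex a) (planeToComplex b) ↔ x ∈ segment ℝ a b := by
  rw [← planeToComplex_image_segment, planeToComplex.injective.mem_set_image]

/-- The closed chain angle of a polygon vanishes at its exterior points. -/
theorem IsExteriorTo.closedChainAngle_eq_zero {p : ℕ → Plane} {m : ℕ} {x : Plane}
    (hx : IsExteriorTo x ((⋃ k ∈ Finset.range m, segment ℝ (p k) (p (k + 1))) ∪
      segment ℝ (p m) (p 0))) :
    closedChainAngle (fun k ↦ planeToComplex (p k)) m (planeToComplex x) = 0 := by
  obtain ⟨hmem, hunb⟩ := hx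
  have hsub := connectedComponentIn_subset ((⋃ k ∈ Finset.range m, segment ℝ (p k) (p (k + 1))) ∪
      segment ℝ (p m) (p 0))ᶜ x
  have hdisj : ∀ {a b : Plane}, segment ℝ a b ⊆ ((⋃ k ∈ Finset.range m,
      segment ℝ (p k) (p (k + 1))) ∪ segment ℝ (p m) (p 0)) →
      Disjoint (planeToComplex '' connectedComponentIn ((⋃ k ∈ Finset.range m,
        segment ℝ (p k) (p (k + 1))) ∪ segment ℝ (p m) (p 0))ᶜ x)
        (segment ℝ (planeToComplex a) (planeToComplex b)) := by
    intro a b h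
    rw [← planeToComplex_image_segment, disjoint_image_iff planeToComplex.injective]
    exact (disjoint_compl_left_iff_subset.2 h).mono_left hsub
  refine _root_.closedChainAngle_eq_zero
    (isPreconnected_connectedComponentIn.image _ planeToComplex.continuous.continuousOn)
    (fun hb ↦ hunb ?_) (fun k hk ↦ hdisj ?_) (hdisj subset_union_right)
    (mem_image_of_mem _ (mem_connectedComponentIn hmem))
  · have := planeToComplex.antilipschitz.isBounded_preimage hb
    rwa [preimage_image_eq _ planeToComplex.injective] at this
  · exact (subset_biUnion_of_mem (u := fun k ↦ segment ℝ (p k) (p (k + 1)))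
      (Finset.mem_coe.2 (Finset.mem_range.2 hk))).trans subset_union_left

/-- If the targets of both robots lie outside each other's cable polygon (and so do the
starting points), then the straight-line segments `[Sᵢ, Tᵢ]` and `[Sⱼ, Tⱼ]` do not intersect. -/
theorem pair_interaction_type1
    (Si Ti Sj Tj : Plane) (Ci Cj : Set Plane)
    (hCi : IsCableLine Si Ti Ci) (hCj : IsCableLine Sj Tj Cj)
    (hdisj : Disjoint Ci Cj)
    (hJi : IsJordanCurve (Ci ∪ segment ℝ Ti Si))
    (hJj : IsJordanCurve (Cj ∪ segment ℝ Tj Sj))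
    (hSi : IsExteriorTo Si (Cj ∪ segment ℝ Tj Sj))
    (hTi : IsExteriorTo Ti (Cj ∪ segment ℝ Tj Sj))
    (hSj : IsExteriorTo Sj (Ci ∪ segment ℝ Ti Si))
    (hTj : IsExteriorTo Tj (Ci ∪ segment ℝ Ti Si)) :
    Disjoint (segment ℝ Si Ti) (segment ℝ Sj Tj) := by
  obtain ⟨m, p, rfl, rfl, rfl⟩ := hCi
  obtain ⟨n, q, rfl, rfl, rfl⟩ := hCj
  have e1 := hSi.closedChainAngle_eq_zero
  have e2 := hTi.closedChainAngle_eq_zero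
  have e3 := hSj.closedChainAngle_eq_zero
  have e4 := hTj.closedChainAngle_eq_zero
  have hcomm := chainAngle_sub_comm (p := fun k ↦ planeToComplex (p k))
    (q := fun k ↦ planeToComplex (q k)) (m := m) (n := n) fun k hk l hl ↦ by
      rw [disjoint_segment_planeToComplex]
      refine hdisj.mono ?_ ?_
      · exact subset_biUnion_of_mem (u := fun k ↦ segment ℝ (p k) (p (k + 1)))
          (Finset.mem_coe.2 (Finset.mem_range.2 hk))
      · exact subset_biUnion_of_mem (u := fun k ↦ segment ℝ (q k) (q (k + 1)))
          (Finset.mem_coe.2 (Finset.mem_range.2 hl))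
  simp only [closedChainAngle] at e1 e2 e3 e4
  rw [← disjoint_segment_planeToComplex]
  apply disjoint_segment_of_subtendedAngle
  · rw [planeToComplex_mem_segment, segment_symm]
    exact fun h ↦ hSi.1 (Or.inr h)
  · rw [planeToComplex_mem_segment, segment_symm]
    exact fun h ↦ hTi.1 (Or.inr h)
  · rw [planeToComplex_mem_segment, segment_symm]
    exact fun h ↦ hSj.1 (Or.inr h)
  · rw [planeToComplex_mem_segment, segment_symm]
    exact fun h ↦ hTj.1 (Or.inr h)
  · linarith
end
end

section
/- Let C_i be a cable line from S_i to T_i and C_j a cable line from S_j to T_j in the plane ℝ², with C_i and C_j disjoint. Let Π_i (respectively Π_j) denote the cable polygon of C_i (respectively C_j), each assumed to be a Jordan curve. If S_i is exterior to Π_j, S_j is exterior to Π_i, T_i lies in the interior of Π_j, and T_j lies in the interior of Π_i, then the closed straight-line segments [S_i, T_i] and [S_j, T_j] do not intersect. -/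
open Set

noncomputable section

theorem exists_continuous_exp_eq {X : Type*} [TopologicalSpace X] [SimplyConnectedSpace X]
    [LocallyPathConnectedSpace X] {g : X → ℂ} (hg : Continuous g) (hg₀ : ∀ x, g x ≠ 0) :
    ∃ h : X → ℂ, Continuous h ∧ ∀ x, Complex.exp (h x) = g x := by
  obtain ⟨x₀⟩ : Nonempty X := inferInstance
  obtain ⟨F, ⟨-, hF⟩, -⟩ := Complex.isCoveringMapOn_exp.existsUnique_continuousMap_lifts
    ⟨g, hg⟩ (a₀ := x₀) (Complex.exp_log (hg₀ x₀)) hg₀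
  exact ⟨F, F.continuous, fun x => congrFun hF x⟩

/-- A continuous function on a preconnected set with values in `2πiℤ` is constant. -/
theorem IsPreconnected.eq_of_exp_eq_one {X : Type*} [TopologicalSpace X] {s : Set X}
    (hs : IsPreconnected s) {g : X → ℂ} (hg : ContinuousOn g s)
    (h1 : ∀ x ∈ s, Complex.exp (g x) = 1) {x y : X} (hx : x ∈ s) (hy : y ∈ s) : g x = g y := by
  have key : ∀ z ∈ s, ∃ n : ℤ, g z = n * (2 * Real.pi * Complex.I) := fun z hz =>
    Complex.exp_eq_one_iff.1 (h1 z hz)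
  have hd : DiscreteTopology (Set.range fun n : ℤ => (n : ℝ)) :=
    Int.isClosedEmbedding_coe_real.isEmbedding.toHomeomorph.symm.isEmbedding.discreteTopology
  have := hs.constant_of_mapsTo (T := Set.range fun n : ℤ => (n : ℝ)) ⟨hd⟩
    (f := fun z => (g z).im / (2 * Real.pi)) (by fun_prop) (by
      intro z hz
      obtain ⟨n, hn⟩ := key z hz
      refine ⟨n, ?_⟩
      simp [hn]) hx hy
  obtain ⟨n, hn⟩ := key x hx
  obtain ⟨m, hm⟩ := key y hy
  rw [hn, hm] at this ⊢
  simp at this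
  rw [this]

/-- The closure of a component of an open set only adds points outside the open set. -/
theorem mem_connectedComponentIn_of_mem_closure {X : Type*} [TopologicalSpace X]
    [LocallyConnectedSpace X] {s : Set X} (hs : IsOpen s) {x z : X} (hz : z ∈ s)
    (h : z ∈ closure (connectedComponentIn s x)) : z ∈ connectedComponentIn s x := by
  obtain ⟨w, hw1, hw2⟩ := mem_closure_iff.1 h _ hs.connectedComponentIn
    (mem_connectedComponentIn hz)
  rw [connectedComponentIn_eq hw2, ← connectedComponentIn_eq hw1]
  exact mem_connectedComponentIn hz

/-- The identity shifted by a point of a bounded component of the complement of a closed set `K`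
admits no continuous logarithm on `K`. -/
theorem not_isBounded_connectedComponentIn_of_exp_eq {K : Set ℂ} (hK : IsClosed K) {x : ℂ}
    (hx : x ∉ K) {H : ℂ → ℂ} (hH : Continuous H) (hHK : ∀ z ∈ K, Complex.exp (H z) = z - x) :
    ¬ Bornology.IsBounded (connectedComponentIn Kᶜ x) := by
  classical
  intro hb
  set U := connectedComponentIn Kᶜ x with hU
  have hxU : x ∈ U := mem_connectedComponentIn hx
  have hUo : IsOpen U := hK.isOpen_compl.connectedComponentIn
  have hfr : ∀ z ∈ frontier U, z ∈ K := by
    intro z hz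
    by_contra hzK
    rw [hUo.frontier_eq] at hz
    exact hz.2 (mem_connectedComponentIn_of_mem_closure hK.isOpen_compl hzK hz.1)
  have hF : Continuous fun z => if z ∈ U then Complex.exp (H z) else z - x :=
    Continuous.if (fun z hz => hHK z (hfr z hz)) (by fun_prop) (by fun_prop)
  obtain ⟨G, hG, hGF⟩ := exists_continuous_exp_eq hF (by
    intro z
    split_ifs with h
    · exact Complex.exp_ne_zero _
    · intro h0
      exact h (by rwa [sub_eq_zero.1 h0]))
  obtain ⟨R, hR0, hR⟩ := hb.subset_ball_lt 0 x
  have hout : ∀ θ : ℝ, Complex.exp (G (x + R * Complex.exp (θ * Complex.I))) =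
      R * Complex.exp (θ * Complex.I) := by
    intro θ
    rw [hGF, if_neg, add_sub_cancel_left]
    intro h
    have := hR h
    simp [Complex.norm_exp, abs_of_pos hR0] at this
  have h01 := isPreconnected_univ.eq_of_exp_eq_one
    (g := fun θ : ℝ => G (x + R * Complex.exp (θ * Complex.I)) - θ * Complex.I - Real.log R)
    (by fun_prop) (by
      intro θ _
      rw [Complex.exp_sub, Complex.exp_sub, hout, ← Complex.ofReal_exp, Real.exp_log hR0]
      have : (R : ℂ) ≠ 0 := by exact_mod_cast hR0.ne'
      have := Complex.exp_ne_zero (θ * Complex.I)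
      field_simp) (mem_univ (0 : ℝ)) (mem_univ (2 * Real.pi))
  simp [Complex.exp_two_pi_mul_I] at h01
  have h02 := congrArg Complex.im h01
  simp at h02
  linarith [Real.pi_pos]

theorem isPreconnected_compl_closedBall_zero {R : ℝ} (hR : 0 < R) :
    IsPreconnected (Metric.closedBall (0 : ℂ) R)ᶜ := by
  have : (Metric.closedBall (0 : ℂ) R)ᶜ = Complex.exp '' {z | Real.log R < z.re} := by
    ext z
    simp only [mem_compl_iff, mem_closedBall_zero_iff, not_le, mem_image, mem_ofPred_eq]
    constructor
    · intro h
      refine ⟨Complex.log z, ?_, Complex.exp_log ?_⟩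
      · rw [Complex.log_re]
        exact Real.log_lt_log hR h
      · rintro rfl
        simp at h
        linarith
    · rintro ⟨w, hw, rfl⟩
      rw [Complex.norm_exp]
      exact (Real.log_lt_iff_lt_exp hR).1 hw
  rw [this]
  exact (convex_halfSpace_re_gt _).isPreconnected.image _ Complex.continuous_exp.continuousOn

/-- A simple arc in the plane has connected complement. -/
theorem isPreconnected_compl_image_Icc {φ : ℝ → ℂ} (hφ : Continuous φ) {a b : ℝ} (hab : a ≤ b)
    (hinj : InjOn φ (Icc a b)) : IsPreconnected (φ '' Icc a b)ᶜ := by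
  set K := φ '' Icc a b with hKdef
  have hKc : IsCompact K := isCompact_Icc.image hφ
  have hunb : ∀ x ∉ K, ¬ Bornology.IsBounded (connectedComponentIn Kᶜ x) := by
    intro x hx
    obtain ⟨h, hh, he⟩ := exists_continuous_exp_eq (X := ℝ)
      (g := fun t => φ (projIcc a b hab t) - x) (by fun_prop) (by
        intro t h0
        exact hx ⟨_, (projIcc a b hab t).2, sub_eq_zero.1 h0⟩)
    have hemb : Topology.IsClosedEmbedding fun t : Icc a b => φ t :=
      Continuous.isClosedEmbedding (by fun_prop) (fun s t hst => Subtype.ext (hinj s.2 t.2 hst))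
    obtain ⟨H, hH⟩ := ContinuousMap.exists_extension' hemb
      (⟨fun t : Icc a b => h t, by fun_prop⟩ : C(Icc a b, ℂ))
    refine not_isBounded_connectedComponentIn_of_exp_eq hKc.isClosed hx H.continuous ?_
    rintro _ ⟨t, ht, rfl⟩
    have h1 : H (φ t) = h t := congrFun hH ⟨t, ht⟩
    rw [h1, he, projIcc_of_mem hab ht]
  obtain ⟨R, hR0, hR⟩ := hKc.isBounded.subset_closedBall_lt 0 0
  have hR' : (Metric.closedBall (0 : ℂ) R)ᶜ ⊆ Kᶜ := compl_subset_compl.2 hR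
  have hmeet : ∀ x ∉ K, ∃ z ∈ connectedComponentIn Kᶜ x, z ∈ (Metric.closedBall (0 : ℂ) R)ᶜ := by
    intro x hx
    by_contra! hcon
    exact hunb x hx (Metric.isBounded_closedBall.subset fun z hz => not_not.1 (hcon z hz))
  refine isPreconnected_of_forall_pair fun x hx y hy => ?_
  obtain ⟨z, hz, hzR⟩ := hmeet x hx
  obtain ⟨w, hw, hwR⟩ := hmeet y hy
  have hzw : w ∈ connectedComponentIn Kᶜ z :=
    (isPreconnected_compl_closedBall_zero hR0).subset_connectedComponentIn hzR hR' hwR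
  refine ⟨connectedComponentIn Kᶜ x, connectedComponentIn_subset _ _, mem_connectedComponentIn hx,
    ?_, isPreconnected_connectedComponentIn⟩
  rw [connectedComponentIn_eq hz, connectedComponentIn_eq hzw, ← connectedComponentIn_eq hw]
  exact mem_connectedComponentIn hy

/-- Every point of a Jordan curve is adherent to every component of its complement. -/
theorem mem_closure_connectedComponentIn_compl_range {f : AddCircle (1 : ℝ) → ℂ}
    (hf : Continuous f) (hinj : Function.Injective f) {x P : ℂ}
    (hP : P ∈ range f) (hx : x ∉ range f) :
    P ∈ closure (connectedComponentIn (range f)ᶜ x) := by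
  by_contra hcon
  set U := connectedComponentIn (range f)ᶜ x with hU
  have hΓ : IsClosed (range f) := (isCompact_range hf).isClosed
  have hUo : IsOpen U := hΓ.isOpen_compl.connectedComponentIn
  obtain ⟨p, rfl⟩ := hP
  obtain ⟨t₀, rfl⟩ := QuotientAddGroup.mk_surjective p
  have hφ : Continuous fun t : ℝ => f (t : AddCircle (1 : ℝ)) :=
    hf.comp (AddCircle.continuous_mk' 1)
  have hnear : ∀ᶠ t : ℝ in nhds t₀, f (t : AddCircle (1 : ℝ)) ∈ (closure U)ᶜ :=
    hφ.continuousAt.eventually (isClosed_closure.isOpen_compl.mem_nhds hcon)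
  obtain ⟨δ, hδ, hball⟩ := Metric.eventually_nhds_iff.1 hnear
  set ε := min (δ / 2) (1 / 4) with hε
  have hε0 : 0 < ε := by positivity
  have hε1 : ε ≤ δ / 2 := min_le_left _ _
  have hε2 : ε ≤ 1 / 4 := min_le_right _ _
  have hinjt : ∀ s t : ℝ, |s - t| < 1 → f (s : AddCircle (1 : ℝ)) = f (t : AddCircle (1 : ℝ)) →
      s = t := by
    intro s t hst h
    have h0 : ((s - t : ℝ) : AddCircle (1 : ℝ)) = 0 := by
      rw [AddCircle.coe_sub, hinj h, sub_self]
    obtain ⟨n, hn⟩ := (AddCircle.coe_eq_zero_iff 1).1 h0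
    rw [zsmul_eq_mul, mul_one] at hn
    rw [← hn] at hst
    have hn0 : n = 0 := Int.abs_lt_one_iff.1 (by exact_mod_cast hst)
    rw [hn0, Int.cast_zero] at hn
    linarith
  set K := (fun t : ℝ => f (t : AddCircle (1 : ℝ))) '' Icc (t₀ + ε) (t₀ + 1 - ε) with hK
  have hKpre : IsPreconnected Kᶜ := by
    refine isPreconnected_compl_image_Icc hφ (by linarith) ?_
    intro s hs t ht h
    exact hinjt s t (abs_lt.2 ⟨by linarith [hs.1, ht.2], by linarith [hs.2, ht.1]⟩) h
  have hKΓ : K ⊆ range f := by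
    rintro _ ⟨t, -, rfl⟩
    exact mem_range_self _
  have hPK : f (t₀ : AddCircle (1 : ℝ)) ∉ K := by
    rintro ⟨t, ht, h⟩
    have := hinjt t t₀ (abs_lt.2 ⟨by linarith [ht.1], by linarith [ht.2]⟩) h
    linarith [ht.1]
  have hcov : Kᶜ ⊆ U ∪ (closure U)ᶜ := by
    intro z hz
    by_cases hzU : z ∈ closure U
    · left
      refine mem_connectedComponentIn_of_mem_closure hΓ.isOpen_compl ?_ hzU
      rintro ⟨q, rfl⟩
      obtain ⟨t, ht, rfl⟩ := (AddCircle.coe_image_Ico_eq 1 (t₀ - ε)).symm ▸ mem_univ q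
      have htK : t < t₀ + ε := by
        by_contra! h
        exact hz ⟨t, ⟨h, by linarith [ht.2]⟩, rfl⟩
      refine hball ?_ hzU
      rw [Real.dist_eq, abs_lt]
      constructor <;> linarith [ht.1]
    · exact Or.inr hzU
  obtain ⟨z, -, hz1, hz2⟩ := hKpre U (closure U)ᶜ hUo isClosed_closure.isOpen_compl hcov
    ⟨x, fun h => hx (hKΓ h), mem_connectedComponentIn hx⟩ ⟨_, hPK, hcon⟩
  exact hz2 (subset_closure hz1)

/-- The increment over `[0, 1]` of a continuous logarithm of `t ↦ A t - x`. -/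
def logIncrement (A : ℝ → ℂ) (x : ℂ) : ℂ :=
  open Classical in
  if h : ∃ h : ℝ → ℂ, Continuous h ∧ ∀ t, Complex.exp (h t) = A t - x then
    h.choose 1 - h.choose 0
  else 0

theorem logIncrement_eq {A h : ℝ → ℂ} {x : ℂ} (hh : Continuous h)
    (he : ∀ t, Complex.exp (h t) = A t - x) : logIncrement A x = h 1 - h 0 := by
  have hex : ∃ h : ℝ → ℂ, Continuous h ∧ ∀ t, Complex.exp (h t) = A t - x := ⟨h, hh, he⟩
  rw [logIncrement, dif_pos hex]
  obtain ⟨hc, hce⟩ := hex.choose_spec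
  have := isPreconnected_univ.eq_of_exp_eq_one (g := fun t => hex.choose t - h t)
    (by fun_prop) (by
      intro t _
      rw [Complex.exp_sub, hce, he, div_self]
      rw [← he]
      exact Complex.exp_ne_zero _) (mem_univ 0) (mem_univ 1)
  linear_combination -this

theorem exp_logIncrement {A : ℝ → ℂ} (hA : Continuous A) {x : ℂ} (hx : ∀ t, A t ≠ x) :
    Complex.exp (logIncrement A x) = (A 1 - x) / (A 0 - x) := by
  obtain ⟨h, hh, he⟩ := exists_continuous_exp_eq (g := fun t => A t - x) (by fun_prop)
    (fun t => sub_ne_zero.2 (hx t))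
  rw [logIncrement_eq hh he, Complex.exp_sub, he, he]

theorem logIncrement_eq_of_dist_lt {A : ℝ → ℂ} (hA : Continuous A) {x z : ℂ}
    (hz : ∀ t, ‖z - x‖ < ‖A t - x‖) :
    logIncrement A z = logIncrement A x + Complex.log ((A 1 - z) / (A 1 - x)) -
      Complex.log ((A 0 - z) / (A 0 - x)) := by
  have hx : ∀ t, A t - x ≠ 0 := fun t => norm_pos_iff.1 ((norm_nonneg _).trans_lt (hz t))
  obtain ⟨h, hh, he⟩ := exists_continuous_exp_eq (g := fun t => A t - x) (by fun_prop) hx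
  have hslit : ∀ t, (A t - z) / (A t - x) ∈ Complex.slitPlane := by
    intro t
    have h1 : (A t - z) / (A t - x) = 1 + -((z - x) / (A t - x)) := by
      have := hx t
      field_simp
      ring
    rw [h1]
    apply Complex.mem_slitPlane_of_norm_lt_one
    rw [norm_neg, norm_div, div_lt_one (norm_pos_iff.2 (hx t))]
    exact hz t
  rw [logIncrement_eq hh he, logIncrement_eq
    (h := fun t => h t + Complex.log ((A t - z) / (A t - x)))]
  · ring
  · refine hh.add (Continuous.clog ?_ hslit)
    exact Continuous.div (by fun_prop) (by fun_prop) hx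
  · intro t
    rw [Complex.exp_add, he, Complex.exp_log (Complex.slitPlane_ne_zero (hslit t)),
      mul_div_cancel₀ _ (hx t)]

theorem continuousAt_logIncrement {A : ℝ → ℂ} (hA : Continuous A) {C : Set ℂ} (hC : IsClosed C)
    (hAC : ∀ t, A t ∈ C) {x : ℂ} (hx : x ∉ C) : ContinuousAt (logIncrement A) x := by
  obtain ⟨r, hr, hball⟩ := Metric.isOpen_iff.1 hC.isOpen_compl x hx
  have hev : ∀ᶠ z in nhds x, logIncrement A x + Complex.log ((A 1 - z) / (A 1 - x)) -
      Complex.log ((A 0 - z) / (A 0 - x)) = logIncrement A z := by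
    filter_upwards [Metric.ball_mem_nhds x hr] with z hz
    refine (logIncrement_eq_of_dist_lt hA fun t => ?_).symm
    have h1 : A t ∉ Metric.ball x r := fun h => hball h (hAC t)
    rw [Metric.mem_ball, dist_eq_norm] at h1 hz
    linarith
  refine ContinuousAt.congr ?_ hev
  have hne : ∀ t, A t - x ≠ 0 := fun t h => hx (by rw [← sub_eq_zero.1 h]; exact hAC t)
  have hlog : ∀ t, ContinuousAt (fun z => Complex.log ((A t - z) / (A t - x))) x := by
    intro t
    refine ContinuousAt.clog (by fun_prop) ?_
    rw [div_self (hne t)]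
    exact Complex.one_mem_slitPlane
  exact (continuousAt_const.add (hlog 1)).sub (hlog 0)

theorem div_mem_slitPlane_of_notMem_segment {S T x : ℂ} (hx : x ∉ segment ℝ T S) :
    (S - x) / (T - x) ∈ Complex.slitPlane := by
  by_contra hcon
  have hT : T - x ≠ 0 := fun h => hx (by rw [← sub_eq_zero.1 h]; exact left_mem_segment ℝ T S)
  rw [Complex.mem_slitPlane_iff, not_or, not_lt, not_not] at hcon
  obtain ⟨c, hc⟩ : ∃ c : ℝ, (S - x) / (T - x) = ((-c : ℝ) : ℂ) :=
    ⟨-((S - x) / (T - x)).re, by apply Complex.ext <;> simp [hcon.2]⟩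
  have hc0 : 0 ≤ c := by
    have := hcon.1
    rw [hc, Complex.ofReal_re] at this
    linarith
  rw [div_eq_iff hT] at hc
  have h1 : (0 : ℝ) < 1 + c := by linarith
  have h1' : (1 + c : ℂ) ≠ 0 := by exact_mod_cast h1.ne'
  refine hx ⟨c / (1 + c), 1 / (1 + c), by positivity, by positivity, by field_simp; ring, ?_⟩
  push_cast at hc
  simp only [Complex.real_smul]
  push_cast
  field_simp
  linear_combination hc

theorem div_im_eq (p q : ℂ) :
    (p / q).im = (p.im * q.re - p.re * q.im) / Complex.normSq q := by
  rw [Complex.div_im]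
  ring

theorem div_re_eq (p q : ℂ) :
    (p / q).re = (p.re * q.re + p.im * q.im) / Complex.normSq q := by
  rw [Complex.div_re]
  ring

/-- The winding number, times `2πi`, of the loop formed by a path `A` and its closing chord. -/
def closedLogIncrement (A : ℝ → ℂ) (x : ℂ) : ℂ :=
  logIncrement A x + Complex.log ((A 0 - x) / (A 1 - x))

theorem exp_closedLogIncrement {A : ℝ → ℂ} (hA : Continuous A) {C : Set ℂ}
    (hAC : ∀ t, A t ∈ C) {x : ℂ} (hx : x ∉ C) :
    Complex.exp (closedLogIncrement A x) = 1 := by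
  have hne : ∀ t, A t - x ≠ 0 := fun t h => hx (by rw [← sub_eq_zero.1 h]; exact hAC t)
  have h0 := hne 0
  have h1 := hne 1
  rw [closedLogIncrement, Complex.exp_add, exp_logIncrement hA fun t => sub_ne_zero.1 (hne t),
    Complex.exp_log (div_ne_zero h0 h1)]
  field_simp

theorem closedLogIncrement_eq_of_mem_connectedComponentIn {A : ℝ → ℂ} (hA : Continuous A)
    {C : Set ℂ} (hC : IsClosed C) (hAC : ∀ t, A t ∈ C) {x y : ℂ}
    (hy : y ∈ connectedComponentIn (C ∪ segment ℝ (A 1) (A 0))ᶜ x) :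
    closedLogIncrement A x = closedLogIncrement A y := by
  have hx : x ∈ (C ∪ segment ℝ (A 1) (A 0))ᶜ := connectedComponentIn_nonempty_iff.1 ⟨y, hy⟩
  refine isPreconnected_connectedComponentIn.eq_of_exp_eq_one ?_ ?_
    (mem_connectedComponentIn hx) hy
  · intro z hz
    have hz' := connectedComponentIn_subset _ _ hz
    refine ContinuousAt.continuousWithinAt ?_
    refine (continuousAt_logIncrement hA hC hAC fun h => hz' (Or.inl h)).add ?_
    refine ContinuousAt.clog (ContinuousAt.div (by fun_prop) (by fun_prop) ?_)
      (div_mem_slitPlane_of_notMem_segment fun h => hz' (Or.inr h))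
    exact fun h => hz' (Or.inl (by rw [← sub_eq_zero.1 h]; exact hAC 1))
  · intro z hz
    exact exp_closedLogIncrement hA hAC fun h => connectedComponentIn_subset _ _ hz (Or.inl h)

/-- The winding number changes by one between the bounded and the unbounded side of a Jordan curve
containing a free piece of the chord. -/
theorem closedLogIncrement_sub_eq {A : ℝ → ℂ} (hA : Continuous A) {C : Set ℂ} (hC : IsClosed C)
    (hAC : ∀ t, A t ∈ C) {f : AddCircle (1 : ℝ) → ℂ}
    (hf : Continuous f) (hinj : Function.Injective f)
    (hΓ : range f = C ∪ segment ℝ (A 1) (A 0)) {P : ℂ} (hP : P ∈ segment ℝ (A 1) (A 0))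
    (hPC : P ∉ C) {x y : ℂ} (hx : x ∉ C ∪ segment ℝ (A 1) (A 0))
    (hy : y ∉ C ∪ segment ℝ (A 1) (A 0))
    (hxb : Bornology.IsBounded (connectedComponentIn (C ∪ segment ℝ (A 1) (A 0))ᶜ x))
    (hyb : ¬ Bornology.IsBounded (connectedComponentIn (C ∪ segment ℝ (A 1) (A 0))ᶜ y)) :
    closedLogIncrement A x - closedLogIncrement A y = 2 * Real.pi * Complex.I ∨
      closedLogIncrement A x - closedLogIncrement A y = -(2 * Real.pi * Complex.I) := by
  set S := A 0 with hS
  set T := A 1 with hT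
  set Γ := C ∪ segment ℝ T S with hΓdef
  have hTP : T - P ≠ 0 := fun h => hPC (by rw [← sub_eq_zero.1 h]; exact hAC 1)
  have hSP : S - P ≠ 0 := fun h => hPC (by rw [← sub_eq_zero.1 h]; exact hAC 0)
  have hPre : ((S - P) / (T - P)).re < 0 := by
    obtain ⟨a, b, ha, hb, hab, h⟩ := hP
    simp only [Complex.real_smul] at h
    have hab' : (a : ℂ) + b = 1 := by exact_mod_cast hab
    have hb0 : b ≠ 0 := by
      rintro rfl
      simp at hab'
      simp [hab'] at h
      exact hTP (sub_eq_zero.2 h)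
    have ha0 : a ≠ 0 := by
      rintro rfl
      simp at hab'
      simp [hab'] at h
      exact hSP (sub_eq_zero.2 h)
    have hb0' : (b : ℂ) ≠ 0 := by exact_mod_cast hb0
    have : (S - P) / (T - P) = ((-(a / b) : ℝ) : ℂ) := by
      rw [div_eq_iff hTP]
      push_cast
      field_simp
      linear_combination h - hab' * P
    rw [this, Complex.ofReal_re, neg_lt_zero]
    positivity
  have hnear : ∀ᶠ z in nhds P, z ∉ C ∧ ((S - z) / (T - z)).re < 0 ∧
      ‖logIncrement A z - logIncrement A P‖ < 1 := by
    refine (hC.isOpen_compl.eventually_mem hPC).and (.and ?_ ?_)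
    · have : ContinuousAt (fun z => ((S - z) / (T - z)).re) P :=
        Complex.continuous_re.continuousAt.comp
          (ContinuousAt.div (by fun_prop) (by fun_prop) hTP)
      exact this.eventually (gt_mem_nhds hPre)
    · have := Metric.continuousAt_iff'.1 (continuousAt_logIncrement hA hC hAC hPC) 1 one_pos
      simpa only [dist_eq_norm] using this
  obtain ⟨ε, hε, hball⟩ := Metric.eventually_nhds_iff_ball.1 hnear
  have hcl : ∀ w ∉ Γ, ∃ w' ∈ connectedComponentIn Γᶜ w, w' ∈ Metric.ball P ε := by
    intro w hw
    have := mem_closure_connectedComponentIn_compl_range hf hinj (x := w) (P := P)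
      (hΓ ▸ Or.inr hP) (hΓ ▸ hw)
    rw [hΓ] at this
    obtain ⟨w', h1, h2⟩ := mem_closure_iff.1 this _ Metric.isOpen_ball (Metric.mem_ball_self hε)
    exact ⟨w', h2, h1⟩
  obtain ⟨x', hx'U, hx'B⟩ := hcl x hx
  obtain ⟨y', hy'U, hy'B⟩ := hcl y hy
  have hx' : x' ∉ Γ := connectedComponentIn_subset _ _ hx'U
  have hy' : y' ∉ Γ := connectedComponentIn_subset _ _ hy'U
  rw [closedLogIncrement_eq_of_mem_connectedComponentIn hA hC hAC hx'U,
    closedLogIncrement_eq_of_mem_connectedComponentIn hA hC hAC hy'U]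
  have him : ∀ z, ((S - z) / (T - z)).im = ((S.im * T.re - S.re * T.im) +
      ((T.im - S.im) * z.re + (S.re - T.re) * z.im)) / Complex.normSq (T - z) := by
    intro z
    rw [div_im_eq]
    simp only [Complex.sub_im, Complex.sub_re]
    ring
  set ℓ : ℂ → ℝ := fun z => (T.im - S.im) * z.re + (S.re - T.re) * z.im with hℓ
  have hlin : IsLinearMap ℝ ℓ := by
    constructor
    · intro z w
      simp [hℓ]
      ring
    · intro c z
      simp [hℓ]
      ring
  set k := S.im * T.re - S.re * T.im with hk
  have hTz : ∀ z ∈ Metric.ball P ε, 0 < Complex.normSq (T - z) := by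
    intro z hz
    refine Complex.normSq_pos.2 fun h => (hball z hz).1 ?_
    rw [← sub_eq_zero.1 h]
    exact hAC 1
  have hseg : ∀ z ∈ segment ℝ T S, k + ℓ z = 0 := by
    rintro z ⟨a, b, -, -, hab, rfl⟩
    obtain rfl : b = 1 - a := by linarith
    simp [hℓ, hk]
    ring
  have hne : ∀ z ∈ Metric.ball P ε, z ∉ Γ → k + ℓ z ≠ 0 := by
    intro z hz hzΓ h
    have h1 := div_mem_slitPlane_of_notMem_segment fun h => hzΓ (Or.inr h)
    rw [Complex.mem_slitPlane_iff, him] at h1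
    rcases h1 with h1 | h1
    · exact absurd h1 (hball z hz).2.1.not_gt
    · rw [h] at h1
      simp at h1
  have hsame : ∀ D : Set ℂ, IsPreconnected D → D ⊆ Γᶜ → x' ∈ D → y' ∈ D → False := by
    intro D hD hDΓ hxD hyD
    have h1 : y' ∈ connectedComponentIn Γᶜ x' := hD.subset_connectedComponentIn hxD hDΓ hyD
    apply hyb
    rw [connectedComponentIn_eq hy'U, ← connectedComponentIn_eq h1, ← connectedComponentIn_eq hx'U]
    exact hxb
  have hpos : ¬ (0 < k + ℓ x' ∧ 0 < k + ℓ y') := by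
    rintro ⟨h1, h2⟩
    refine hsame (Metric.ball P ε ∩ {z | -k < ℓ z})
      ((convex_ball P ε).inter (convex_halfSpace_gt hlin _)).isPreconnected ?_
      ⟨hx'B, by simp; linarith⟩ ⟨hy'B, by simp; linarith⟩
    rintro z ⟨hz1, hz2⟩ (h | h)
    · exact (hball z hz1).1 h
    · have := hseg z h
      simp at hz2
      linarith
  have hneg : ¬ (k + ℓ x' < 0 ∧ k + ℓ y' < 0) := by
    rintro ⟨h1, h2⟩
    refine hsame (Metric.ball P ε ∩ {z | ℓ z < -k})
      ((convex_ball P ε).inter (convex_halfSpace_lt hlin _)).isPreconnected ?_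
      ⟨hx'B, by simp; linarith⟩ ⟨hy'B, by simp; linarith⟩
    rintro z ⟨hz1, hz2⟩ (h | h)
    · exact (hball z hz1).1 h
    · have := hseg z h
      simp at hz2
      linarith
  have hargpos : ∀ z ∈ Metric.ball P ε, 0 < k + ℓ z →
      Real.pi / 2 < ((S - z) / (T - z)).arg ∧ ((S - z) / (T - z)).arg ≤ Real.pi := by
    intro z hz h
    refine ⟨?_, Complex.arg_le_pi _⟩
    have h1 : 0 ≤ ((S - z) / (T - z)).arg :=
      Complex.arg_nonneg_iff.2 (by rw [him]; exact (div_pos h (hTz z hz)).le)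
    by_contra! h2
    exact absurd (Complex.abs_arg_le_pi_div_two_iff.1 (by rwa [abs_of_nonneg h1]))
      (hball z hz).2.1.not_ge
  have hargneg : ∀ z ∈ Metric.ball P ε, k + ℓ z < 0 →
      ((S - z) / (T - z)).arg < -(Real.pi / 2) ∧ -Real.pi < ((S - z) / (T - z)).arg := by
    intro z hz h
    refine ⟨?_, Complex.neg_pi_lt_arg _⟩
    have h1 : ((S - z) / (T - z)).arg < 0 :=
      Complex.arg_neg_iff.2 (by rw [him]; exact div_neg_of_neg_of_pos h (hTz z hz))
    by_contra! h2
    exact absurd (Complex.abs_arg_le_pi_div_two_iff.1 (by rw [abs_of_neg h1]; linarith))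
      (hball z hz).2.1.not_ge
  have hexp : Complex.exp (closedLogIncrement A x' - closedLogIncrement A y') = 1 := by
    rw [Complex.exp_sub, exp_closedLogIncrement hA hAC fun h => hx' (Or.inl h),
      exp_closedLogIncrement hA hAC fun h => hy' (Or.inl h), div_one]
  obtain ⟨n, hn⟩ := Complex.exp_eq_one_iff.1 hexp
  have hnim : (closedLogIncrement A x' - closedLogIncrement A y').im = n * (2 * Real.pi) := by
    rw [hn]
    simp
  have hdx := (Complex.abs_im_le_norm _).trans_lt (hball x' hx'B).2.2
  have hdy := (Complex.abs_im_le_norm _).trans_lt (hball y' hy'B).2.2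
  simp only [closedLogIncrement, Complex.sub_im, Complex.add_im, Complex.log_im] at hnim hdx hdy
  rw [abs_lt] at hdx hdy
  have hpi := Real.pi_gt_three
  rcases lt_or_gt_of_ne (hne x' hx'B hx') with hsx | hsx <;>
    rcases lt_or_gt_of_ne (hne y' hy'B hy') with hsy | hsy
  · exact absurd ⟨hsx, hsy⟩ hneg
  · right
    have hax := hargneg x' hx'B hsx
    have hay := hargpos y' hy'B hsy
    have h1 : (n : ℝ) < 0 := by
      by_contra! h
      have : 0 ≤ n * (2 * Real.pi) := by positivity
      linarith
    have h2 : (-2 : ℝ) < n := by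
      by_contra! h
      have : n * (2 * Real.pi) ≤ -2 * (2 * Real.pi) := by gcongr
      linarith
    have h1' : n < 0 := by exact_mod_cast h1
    have h2' : -2 < n := by exact_mod_cast h2
    obtain rfl : n = -1 := by omega
    rw [hn]
    push_cast
    ring
  · left
    have hax := hargpos x' hx'B hsx
    have hay := hargneg y' hy'B hsy
    have h1 : (0 : ℝ) < n := by
      by_contra! h
      have : n * (2 * Real.pi) ≤ 0 := mul_nonpos_of_nonpos_of_nonneg h (by positivity)
      linarith
    have h2 : (n : ℝ) < 2 := by
      by_contra! h
      have : 2 * (2 * Real.pi) ≤ n * (2 * Real.pi) := by gcongr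
      linarith
    have h1' : 0 < n := by exact_mod_cast h1
    have h2' : n < 2 := by exact_mod_cast h2
    obtain rfl : n = 1 := by omega
    rw [hn]
    push_cast
    ring
  · exact absurd ⟨hsx, hsy⟩ hpos

theorem div_mem_slitPlane_re_pos {p q : ℂ} (hpq : p / q ∈ Complex.slitPlane)
    (h0 : p.im * q.re - p.re * q.im = 0) : 0 < p.re * q.re + p.im * q.im := by
  have hq : 0 < Complex.normSq q := by
    refine Complex.normSq_pos.2 ?_
    rintro rfl
    simp [Complex.mem_slitPlane_iff] at hpq
  rw [Complex.mem_slitPlane_iff, div_im_eq, div_re_eq, h0, zero_div] at hpq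
  rcases hpq with h | h
  · exact (div_pos_iff_of_pos_right hq).1 h
  · exact absurd rfl h

theorem div_im_pos {p q : ℂ} (h : 0 < p.im * q.re - p.re * q.im) : 0 < (p / q).im := by
  rw [div_im_eq]
  refine div_pos h (Complex.normSq_pos.2 ?_)
  rintro rfl
  simp at h

theorem div_im_neg {p q : ℂ} (h : p.im * q.re - p.re * q.im < 0) : (p / q).im < 0 := by
  rw [div_im_eq]
  refine div_neg_of_neg_of_pos h (Complex.normSq_pos.2 ?_)
  rintro rfl
  simp at h

theorem exists_param_of_mem_segment {S T Q : ℂ} (hQ : Q ∈ segment ℝ T S) (hS : Q ≠ S)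
    (hT : Q ≠ T) : ∃ a : ℝ, 0 < a ∧ a < 1 ∧ S.re = Q.re - a * (T.re - S.re) ∧
      S.im = Q.im - a * (T.im - S.im) ∧ T.re = Q.re + (1 - a) * (T.re - S.re) ∧
      T.im = Q.im + (1 - a) * (T.im - S.im) := by
  obtain ⟨a, b, ha, hb, hab, rfl⟩ := hQ
  obtain rfl : b = 1 - a := by linarith
  have ha0 : a ≠ 0 := by
    rintro rfl
    simp at hS
  have ha1 : a ≠ 1 := by
    rintro rfl
    simp at hT
  refine ⟨a, lt_of_le_of_ne ha ha0.symm, lt_of_le_of_ne (by linarith) ha1, ?_, ?_, ?_, ?_⟩ <;>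
  · simp
    ring

/-- The four angles of a convex quadrilateral with crossing diagonals `[S, T]` and `[S', T']` have
a common sign, so that their sum is nonzero and of absolute value less than `4π`. -/
theorem arg_sum_ne_zero_and_abs_lt_of_mem_segment {S T S' T' Q : ℂ} (hQ : Q ∈ segment ℝ T S)
    (hQ' : Q ∈ segment ℝ T' S') (hS : S ∉ segment ℝ T' S') (hT : T ∉ segment ℝ T' S')
    (hS' : S' ∉ segment ℝ T S) (hT' : T' ∉ segment ℝ T S) {θ : ℝ}
    (hθ : θ = ((S - T') / (T - T')).arg - ((S - S') / (T - S')).arg -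
      (((S' - T) / (T' - T)).arg - ((S' - S) / (T' - S)).arg)) :
    θ ≠ 0 ∧ |θ| < 4 * Real.pi := by
  have h1 := div_mem_slitPlane_of_notMem_segment hT'
  have h2 := div_mem_slitPlane_of_notMem_segment hS'
  have h3 := div_mem_slitPlane_of_notMem_segment hT
  have h4 := div_mem_slitPlane_of_notMem_segment hS
  obtain ⟨a, ha0, ha1, e1, e2, e3, e4⟩ := exists_param_of_mem_segment hQ
    (fun h => hS (h ▸ hQ')) (fun h => hT (h ▸ hQ'))
  obtain ⟨b, hb0, hb1, e5, e6, e7, e8⟩ := exists_param_of_mem_segment hQ'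
    (fun h => hS' (h ▸ hQ)) (fun h => hT' (h ▸ hQ))
  generalize hu1 : T.re - S.re = u1 at e1 e3
  generalize hu2 : T.im - S.im = u2 at e2 e4
  generalize hv1 : T'.re - S'.re = v1 at e5 e7
  generalize hv2 : T'.im - S'.im = v2 at e6 e8
  have d1 : (S - T').im * (T - T').re - (S - T').re * (T - T').im =
      -((1 - b) * (u1 * v2 - u2 * v1)) := by
    simp only [Complex.sub_re, Complex.sub_im, e1, e2, e3, e4, e7, e8]
    ring
  have d2 : (S - S').im * (T - S').re - (S - S').re * (T - S').im =
      b * (u1 * v2 - u2 * v1) := by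
    simp only [Complex.sub_re, Complex.sub_im, e1, e2, e3, e4, e5, e6]
    ring
  have d3 : (S' - T).im * (T' - T).re - (S' - T).re * (T' - T).im =
      (1 - a) * (u1 * v2 - u2 * v1) := by
    simp only [Complex.sub_re, Complex.sub_im, e5, e6, e3, e4, e7, e8]
    ring
  have d4 : (S' - S).im * (T' - S).re - (S' - S).re * (T' - S).im =
      -(a * (u1 * v2 - u2 * v1)) := by
    simp only [Complex.sub_re, Complex.sub_im, e1, e2, e5, e6, e7, e8]
    ring
  have ha1' : 0 < 1 - a := by linarith
  have hb1' : 0 < 1 - b := by linarith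
  rcases lt_trichotomy (u1 * v2 - u2 * v1) 0 with hd | hd | hd
  · have i1 := div_im_pos (d1 ▸ neg_pos.2 (mul_neg_of_pos_of_neg hb1' hd))
    have i2 := div_im_neg (d2 ▸ mul_neg_of_pos_of_neg hb0 hd)
    have i3 := div_im_neg (d3 ▸ mul_neg_of_pos_of_neg ha1' hd)
    have i4 := div_im_pos (d4 ▸ neg_pos.2 (mul_neg_of_pos_of_neg ha0 hd))
    have j1 := Complex.arg_nonneg_iff.2 i1.le
    have j2 := Complex.arg_neg_iff.2 i2
    have j3 := Complex.arg_neg_iff.2 i3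
    have j4 := Complex.arg_nonneg_iff.2 i4.le
    have k1 := Complex.arg_le_pi ((S - T') / (T - T'))
    have k2 := Complex.neg_pi_lt_arg ((S - S') / (T - S'))
    have k3 := Complex.neg_pi_lt_arg ((S' - T) / (T' - T))
    have k4 := Complex.arg_le_pi ((S' - S) / (T' - S))
    rw [abs_lt]
    exact ⟨by linarith, by linarith, by linarith⟩
  · rw [hd, mul_zero] at d2 d3
    rw [hd, mul_zero, neg_zero] at d1 d4
    have r1 := div_mem_slitPlane_re_pos h1 d1
    have r2 := div_mem_slitPlane_re_pos h2 d2
    have r3 := div_mem_slitPlane_re_pos h3 d3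
    have r4 := div_mem_slitPlane_re_pos h4 d4
    simp only [Complex.sub_re, Complex.sub_im, e1, e2, e3, e4, e5, e6, e7, e8] at r1 r2 r3 r4
    exfalso
    linarith [mul_pos hb0 r1, mul_pos hb1' r2, mul_pos ha0 r3, mul_pos ha1' r4]
  · have i1 := div_im_neg (d1 ▸ neg_lt_zero.2 (mul_pos hb1' hd))
    have i2 := div_im_pos (d2 ▸ mul_pos hb0 hd)
    have i3 := div_im_pos (d3 ▸ mul_pos ha1' hd)
    have i4 := div_im_neg (d4 ▸ neg_lt_zero.2 (mul_pos ha0 hd))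
    have j1 := Complex.arg_neg_iff.2 i1
    have j2 := Complex.arg_nonneg_iff.2 i2.le
    have j3 := Complex.arg_nonneg_iff.2 i3.le
    have j4 := Complex.arg_neg_iff.2 i4
    have k1 := Complex.neg_pi_lt_arg ((S - T') / (T - T'))
    have k2 := Complex.arg_le_pi ((S - S') / (T - S'))
    have k3 := Complex.arg_le_pi ((S' - T) / (T' - T))
    have k4 := Complex.neg_pi_lt_arg ((S' - S) / (T' - S))
    rw [abs_lt]
    exact ⟨by linarith, by linarith, by linarith⟩

/-- Exchanging the roles of two disjoint paths. -/
theorem logIncrement_sub_logIncrement_comm {A B : ℝ → ℂ} (hA : Continuous A) (hB : Continuous B)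
    (hAB : ∀ s t, A s ≠ B t) :
    logIncrement A (B 1) - logIncrement A (B 0) = logIncrement B (A 1) - logIncrement B (A 0) := by
  obtain ⟨H, hH, he⟩ := exists_continuous_exp_eq (X := ℝ × ℝ)
    (g := fun p => A p.1 - B p.2) (by fun_prop) (fun p => sub_ne_zero.2 (hAB _ _))
  have hAi : ∀ t, logIncrement A (B t) = H (1, t) - H (0, t) := fun t =>
    logIncrement_eq (h := fun s => H (s, t)) (by fun_prop) fun s => he (s, t)
  have hBi : ∀ s, logIncrement B (A s) = (H (s, 1) + Real.pi * Complex.I) -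
      (H (s, 0) + Real.pi * Complex.I) := fun s =>
    logIncrement_eq (h := fun t => H (s, t) + Real.pi * Complex.I) (by fun_prop) fun t => by
      rw [Complex.exp_add, he, Complex.exp_pi_mul_I]
      ring
  rw [hAi, hAi, hBi, hBi]
  ring

/-- If `C'` avoids `C` and joins points on different sides of the curve formed by `C` and its chord,
then `C` does not cover the chord. -/
theorem exists_mem_segment_notMem_of_joinedIn {S T S' T' : ℂ} {C C' : Set ℂ} (hC' : JoinedIn C' S' T')
    (hdisj : Disjoint C C')
    (hS' : ¬ Bornology.IsBounded (connectedComponentIn (C ∪ segment ℝ T S)ᶜ S'))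
    (hT' : Bornology.IsBounded (connectedComponentIn (C ∪ segment ℝ T S)ᶜ T')) :
    ∃ P ∈ segment ℝ T S, P ∉ C := by
  by_contra! hcon
  rw [union_eq_self_of_subset_right hcon] at hS' hT'
  obtain ⟨γ, hγ⟩ := hC'
  have hsub : range γ ⊆ Cᶜ := by
    rintro _ ⟨t, rfl⟩ h
    exact disjoint_left.1 hdisj h (hγ t)
  have := (isPreconnected_range γ.continuous).subset_connectedComponentIn
    (⟨0, γ.source⟩ : S' ∈ range γ) hsub (⟨1, γ.target⟩ : T' ∈ range γ)
  rw [connectedComponentIn_eq this] at hS'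
  contradiction

/-- Two paths whose closures by chords are Jordan curves, each curve separating the endpoints of the
other path, have disjoint chords. -/
theorem disjoint_segment_of_jordan {S T S' T' : ℂ} {C C' : Set ℂ}
    (hC : JoinedIn C S T) (hC' : JoinedIn C' S' T') (hCc : IsClosed C) (hCc' : IsClosed C')
    (hdisj : Disjoint C C') {f f' : AddCircle (1 : ℝ) → ℂ}
    (hf : Continuous f) (hinj : Function.Injective f) (hΓ : range f = C ∪ segment ℝ T S)
    (hf' : Continuous f') (hinj' : Function.Injective f') (hΓ' : range f' = C' ∪ segment ℝ T' S')
    (hS : S ∉ C' ∪ segment ℝ T' S')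
    (hSu : ¬ Bornology.IsBounded (connectedComponentIn (C' ∪ segment ℝ T' S')ᶜ S))
    (hS' : S' ∉ C ∪ segment ℝ T S)
    (hSu' : ¬ Bornology.IsBounded (connectedComponentIn (C ∪ segment ℝ T S)ᶜ S'))
    (hT : T ∉ C' ∪ segment ℝ T' S')
    (hTb : Bornology.IsBounded (connectedComponentIn (C' ∪ segment ℝ T' S')ᶜ T))
    (hT' : T' ∉ C ∪ segment ℝ T S)
    (hTb' : Bornology.IsBounded (connectedComponentIn (C ∪ segment ℝ T S)ᶜ T')) :
    Disjoint (segment ℝ T S) (segment ℝ T' S') := by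
  rw [disjoint_left]
  intro Q hQ hQ'
  obtain ⟨P, hP, hPC⟩ := exists_mem_segment_notMem_of_joinedIn hC' hdisj hSu' hTb'
  obtain ⟨P', hP', hPC'⟩ := exists_mem_segment_notMem_of_joinedIn hC hdisj.symm hSu hTb
  obtain ⟨γ, hγ⟩ := hC
  obtain ⟨γ', hγ'⟩ := hC'
  have h0 : γ.extend 0 = S := γ.extend_zero
  have h1 : γ.extend 1 = T := γ.extend_one
  have h0' : γ'.extend 0 = S' := γ'.extend_zero
  have h1' : γ'.extend 1 = T' := γ'.extend_one
  have hAC : ∀ t, γ.extend t ∈ C := fun t => hγ _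
  have hAC' : ∀ t, γ'.extend t ∈ C' := fun t => hγ' _
  have hcomm := logIncrement_sub_logIncrement_comm γ.continuous_extend γ'.continuous_extend
    (fun s t h => disjoint_left.1 hdisj (hAC s) (h ▸ hAC' t))
  have hj := closedLogIncrement_sub_eq γ.continuous_extend hCc hAC hf hinj (by rwa [h0, h1])
    (by rwa [h0, h1]) hPC (x := T') (y := S') (by rwa [h0, h1]) (by rwa [h0, h1])
    (by rwa [h0, h1]) (by rwa [h0, h1])
  have hj' := closedLogIncrement_sub_eq γ'.continuous_extend hCc' hAC' hf' hinj' (by rwa [h0', h1'])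
    (by rwa [h0', h1']) hPC' (x := T) (y := S) (by rwa [h0', h1']) (by rwa [h0', h1'])
    (by rwa [h0', h1']) (by rwa [h0', h1'])
  simp only [closedLogIncrement, h0, h1, h0', h1'] at hcomm hj hj'
  obtain ⟨hne, hlt⟩ := arg_sum_ne_zero_and_abs_lt_of_mem_segment hQ hQ' (fun h => hS (Or.inr h))
    (fun h => hT (Or.inr h)) (fun h => hS' (Or.inr h)) (fun h => hT' (Or.inr h)) rfl
  have hcommi := congrArg Complex.im hcomm
  have hji := hj.imp (congrArg Complex.im) (congrArg Complex.im)
  have hji' := hj'.imp (congrArg Complex.im) (congrArg Complex.im)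
  simp only [Complex.sub_im, Complex.add_im, Complex.log_im, Complex.neg_im] at hcommi hji hji'
  have hpi : (2 * Real.pi * Complex.I).im = 2 * Real.pi := by simp
  rw [hpi] at hji hji'
  rw [abs_lt] at hlt
  rcases hji with h | h <;> rcases hji' with h' | h'
  · exact hne (by linarith)
  · linarith
  · linarith
  · exact hne (by linarith)

theorem joinedIn_biUnion_segment {E : Type*} [AddCommGroup E] [Module ℝ E] [TopologicalSpace E]
    [ContinuousAdd E] [ContinuousSMul ℝ E] (p : ℕ → E) (m : ℕ) :
    JoinedIn (⋃ k ∈ Finset.range (m + 1), segment ℝ (p k) (p (k + 1))) (p 0) (p (m + 1)) := by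
  have hseg : ∀ k, JoinedIn (segment ℝ (p k) (p (k + 1))) (p k) (p (k + 1)) := fun k =>
    ((convex_segment _ _).isPathConnected ⟨_, left_mem_segment ℝ _ _⟩).joinedIn _
      (left_mem_segment ℝ _ _) _ (right_mem_segment ℝ _ _)
  have hsub : ∀ n k, k < n → segment ℝ (p k) (p (k + 1)) ⊆
      ⋃ k ∈ Finset.range n, segment ℝ (p k) (p (k + 1)) := fun n k hk =>
    subset_biUnion_of_mem (u := fun k => segment ℝ (p k) (p (k + 1)))
      (show k ∈ (Finset.range n : Set ℕ) by simpa using hk)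
  induction m with
  | zero => exact (hseg 0).mono (hsub _ _ (by simp))
  | succ m ih =>
    refine (ih.mono ?_).trans ((hseg (m + 1)).mono (hsub _ _ (by simp)))
    exact biUnion_subset_biUnion_left fun k hk => by simp at hk ⊢; omega

theorem IsCableLine.joinedIn {S T : Plane} {C : Set Plane} (h : IsCableLine S T C) (hST : S ≠ T) :
    JoinedIn C S T := by
  obtain ⟨m, p, rfl, rfl, rfl⟩ := h
  cases m with
  | zero => exact absurd rfl hST
  | succ m => exact joinedIn_biUnion_segment p m

theorem IsCableLine.isCompact {S T : Plane} {C : Set Plane} (h : IsCableLine S T C) :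
    IsCompact C := by
  obtain ⟨m, p, -, -, rfl⟩ := h
  refine (Finset.range m).isCompact_biUnion fun k _ => ?_
  rw [segment_eq_image_lineMap]
  exact isCompact_Icc.image AffineMap.lineMap_continuous

/-- The standard identification of the Euclidean plane with the complex numbers. -/
def planeEquivComplex : Plane ≃ₗᵢ[ℝ] ℂ := Complex.orthonormalBasisOneI.repr.symm

theorem planeEquivComplex_image_union_segment (C : Set Plane) (S T : Plane) :
    planeEquivComplex '' (C ∪ segment ℝ T S) =
      planeEquivComplex '' C ∪ segment ℝ (planeEquivComplex T) (planeEquivComplex S) := by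
  rw [image_union]
  congr 1
  exact image_segment ℝ planeEquivComplex.toLinearEquiv.toLinearMap.toAffineMap T S

theorem isBounded_connectedComponentIn_image_iff {Γ : Set Plane} {x : Plane} (hx : x ∉ Γ) :
    Bornology.IsBounded (connectedComponentIn (planeEquivComplex '' Γ)ᶜ (planeEquivComplex x)) ↔
      Bornology.IsBounded (connectedComponentIn Γᶜ x) := by
  rw [← image_compl_eq planeEquivComplex.bijective]
  have := planeEquivComplex.toHomeomorph.image_connectedComponentIn (s := Γᶜ) hx
  rw [show planeEquivComplex '' Γᶜ = planeEquivComplex.toHomeomorph '' Γᶜ from rfl,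
    show planeEquivComplex x = planeEquivComplex.toHomeomorph x from rfl, ← this]
  refine ⟨fun h => ?_, fun h => planeEquivComplex.lipschitz.isBounded_image h⟩
  have := planeEquivComplex.symm.lipschitz.isBounded_image h
  rw [← image_comp] at this
  simpa using this

theorem IsJordanCurve.exists_complex {Γ : Set Plane} (h : IsJordanCurve Γ) :
    ∃ f : AddCircle (1 : ℝ) → ℂ, Continuous f ∧ Function.Injective f ∧
      range f = planeEquivComplex '' Γ := by
  obtain ⟨f, hf, hinj, rfl⟩ := h
  exact ⟨planeEquivComplex ∘ f, planeEquivComplex.continuous.comp hf,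
    planeEquivComplex.injective.comp hinj, range_comp _ _⟩

/-- If each robot's target lies in the interior of the other robot's cable polygon
(while the starting points are exterior), then the straight-line segments
`[Sᵢ, Tᵢ]` and `[Sⱼ, Tⱼ]` do not intersect (a pair deadlock). -/
theorem pair_interaction_type4
    (Si Ti Sj Tj : Plane) (Ci Cj : Set Plane)
    (hCi : IsCableLine Si Ti Ci) (hCj : IsCableLine Sj Tj Cj)
    (hdisj : Disjoint Ci Cj)
    (hJi : IsJordanCurve (Ci ∪ segment ℝ Ti Si))
    (hJj : IsJordanCurve (Cj ∪ segment ℝ Tj Sj))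
    (hSi : IsExteriorTo Si (Cj ∪ segment ℝ Tj Sj))
    (hSj : IsExteriorTo Sj (Ci ∪ segment ℝ Ti Si))
    (hTi : Ti ∈ curveInterior (Cj ∪ segment ℝ Tj Sj))
    (hTj : Tj ∈ curveInterior (Ci ∪ segment ℝ Ti Si)) :
    Disjoint (segment ℝ Si Ti) (segment ℝ Sj Tj) := by
  have hSTi : Si ≠ Ti := by
    rintro rfl
    exact hSi.2 hTi.2
  have hSTj : Sj ≠ Tj := by
    rintro rfl
    exact hSj.2 hTj.2
  obtain ⟨f, hf, hinj, hfr⟩ := hJi.exists_complex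
  obtain ⟨g, hg, hginj, hgr⟩ := hJj.exists_complex
  have hmem : ∀ {x Γ}, x ∉ Γ → planeEquivComplex x ∉ planeEquivComplex '' Γ := fun hx h =>
    hx ((planeEquivComplex.injective.mem_set_image).1 h)
  have hSiu := mt (isBounded_connectedComponentIn_image_iff hSi.1).1 hSi.2
  have hSju := mt (isBounded_connectedComponentIn_image_iff hSj.1).1 hSj.2
  have hTib := (isBounded_connectedComponentIn_image_iff hTi.1).2 hTi.2
  have hTjb := (isBounded_connectedComponentIn_image_iff hTj.1).2 hTj.2
  have hSim := hmem hSi.1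
  have hSjm := hmem hSj.1
  have hTim := hmem hTi.1
  have hTjm := hmem hTj.1
  rw [planeEquivComplex_image_union_segment] at hfr hgr hSiu hSju hTib hTjb hSim hSjm hTim hTjm
  have key := disjoint_segment_of_jordan
    ((hCi.joinedIn hSTi).map planeEquivComplex.continuous)
    ((hCj.joinedIn hSTj).map planeEquivComplex.continuous)
    (hCi.isCompact.image planeEquivComplex.continuous).isClosed
    (hCj.isCompact.image planeEquivComplex.continuous).isClosed
    ((disjoint_image_iff planeEquivComplex.injective).2 hdisj)
    hf hinj hfr hg hginj hgr hSim hSiu hSjm hSju hTim hTib hTjm hTjb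
  have himg : ∀ a b, segment ℝ (planeEquivComplex a) (planeEquivComplex b) =
      planeEquivComplex '' segment ℝ a b := fun a b =>
    (image_segment ℝ planeEquivComplex.toLinearEquiv.toLinearMap.toAffineMap a b).symm
  rw [himg, himg, disjoint_image_iff planeEquivComplex.injective] at key
  rwa [segment_symm ℝ Si, segment_symm ℝ Sj]
end
end

section
/- Let Π be a simple closed polygon in ℝ² with vertices v_0, v_1, ..., v_{m−1}, i.e. the union of the edges [v_k, v_{k+1 mod m}] for k = 0, ..., m−1, assumed to be a Jordan curve. Let S be a point exterior to Π and T a point with T ∉ Π. Suppose the closed straight-line segment [S, T] meets Π in a finite set F of points such that no point of F is a vertex v_k of Π and, for every P ∈ F, the segment [S, T] is not parallel to the (unique) edge of Π containing P. Then T lies in the interior of Π if and only if the cardinality of F is odd. -/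
open Set

noncomputable section

section Separation

open Topology Metric

theorem IsPreconnected.mem_iff_mem_of_eventually {X : Type*} [TopologicalSpace X] {A s : Set X}
    (hA : IsPreconnected A) (h : ∀ x ∈ A, ∀ᶠ y in 𝓝[A] x, (y ∈ s ↔ x ∈ s))
    {x y : X} (hx : x ∈ A) (hy : y ∈ A) : x ∈ s ↔ y ∈ s := by
  refine hA.induction₂ (fun x y => (x ∈ s ↔ y ∈ s)) (fun x hx => ?_) ?_ ?_ hx hy
  · filter_upwards [h x hx] with y hy using hy.symm
  · intro x y z _ _ _ h₁ h₂
    exact h₁.trans h₂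
  · intro x y _ _ h₁
    exact h₁.symm

/-- `Γ` is locally two-sided if every point of `Γ` has arbitrarily small neighbourhoods which
`Γ` cuts into two disjoint open connected sides, both of them adherent to the whole of `Γ`. -/
def LocallyTwoSided {X : Type*} [TopologicalSpace X] (Γ : Set X) : Prop :=
  ∀ P ∈ Γ, ∀ U ∈ 𝓝 P, ∃ B A₁ A₂ : Set X, IsOpen B ∧ P ∈ B ∧ B ⊆ U ∧ B \ Γ = A₁ ∪ A₂ ∧
    Disjoint A₁ A₂ ∧ IsOpen A₁ ∧ IsOpen A₂ ∧ IsPreconnected A₁ ∧ IsPreconnected A₂ ∧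
    B ∩ Γ ⊆ closure A₁ ∧ B ∩ Γ ⊆ closure A₂

/-- Near `R`, the set `χ` is one of the local sides of `Γ`. -/
def SeparatesAt {X : Type*} [TopologicalSpace X] (Γ χ : Set X) (R : X) : Prop :=
  (R ∉ Γ → ∀ᶠ y in 𝓝 R, (y ∈ χ ↔ R ∈ χ)) ∧
    (R ∈ Γ → R ∈ closure (χ \ Γ) ∧ R ∈ closure (χᶜ \ Γ))

section Topological

variable {X : Type*} [TopologicalSpace X] {Γ χ χ' : Set X}

theorem SeparatesAt.compl {R : X} (h : SeparatesAt Γ χ R) : SeparatesAt Γ χᶜ R := by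
  refine ⟨fun hR => ?_, fun hR => ⟨(h.2 hR).2, by simpa using (h.2 hR).1⟩⟩
  filter_upwards [h.1 hR] with y hy
  simp [hy]

theorem mem_closure_of_eventually {s t : Set X} {R : X} (hR : R ∈ closure s)
    (h : ∀ᶠ y in 𝓝 R, y ∈ s → y ∈ t) : R ∈ closure t := by
  rw [mem_closure_iff_frequently] at hR ⊢
  exact hR.mp h

theorem SeparatesAt.congr (hΓ : IsClosed Γ) {R : X} (h : SeparatesAt Γ χ R)
    (hχ : ∀ᶠ y in 𝓝 R, y ∉ Γ → (y ∈ χ ↔ y ∈ χ')) : SeparatesAt Γ χ' R := by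
  refine ⟨fun hR => ?_, fun hR => ⟨?_, ?_⟩⟩
  · filter_upwards [h.1 hR, hχ, hΓ.isOpen_compl.mem_nhds hR] with y h₁ h₂ h₃
    rw [← h₂ h₃, h₁, hχ.self_of_nhds hR]
  · refine mem_closure_of_eventually (h.2 hR).1 ?_
    filter_upwards [hχ] with y hy hy'
    exact ⟨(hy hy'.2).1 hy'.1, hy'.2⟩
  · refine mem_closure_of_eventually (h.2 hR).2 ?_
    filter_upwards [hχ] with y hy hy'
    exact ⟨fun h => hy'.1 ((hy hy'.2).2 h), hy'.2⟩

theorem IsPreconnected.mem_iff_mem_of_separatesAt {A : Set X} (hA : IsPreconnected A)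
    (hAΓ : Disjoint A Γ) (h : ∀ R ∈ A, SeparatesAt Γ χ R) {x y : X} (hx : x ∈ A) (hy : y ∈ A) :
    x ∈ χ ↔ y ∈ χ :=
  hA.mem_iff_mem_of_eventually (fun z hz =>
    ((h z hz).1 (hAΓ.notMem_of_mem_left hz)).filter_mono nhdsWithin_le_nhds) hx hy

theorem sides_of_separatesAt {B A₁ A₂ : Set X} {P : X} (hB : IsOpen B) (hP : P ∈ B) (hPΓ : P ∈ Γ)
    (hA : B \ Γ = A₁ ∪ A₂) (hA₁ : IsPreconnected A₁) (hA₂ : IsPreconnected A₂)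
    (hχ : ∀ R ∈ B, SeparatesAt Γ χ R) :
    (A₁ ⊆ χ ∧ A₂ ⊆ χᶜ) ∨ (A₁ ⊆ χᶜ ∧ A₂ ⊆ χ) := by
  have h₁ : A₁ ⊆ B \ Γ := hA ▸ subset_union_left
  have h₂ : A₂ ⊆ B \ Γ := hA ▸ subset_union_right
  have hc₁ : ∀ x ∈ A₁, ∀ y ∈ A₁, (x ∈ χ ↔ y ∈ χ) := fun x hx y hy =>
    hA₁.mem_iff_mem_of_separatesAt (disjoint_left.2 fun z hz => (h₁ hz).2)
      (fun R hR => hχ R (h₁ hR).1) hx hy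
  have hc₂ : ∀ x ∈ A₂, ∀ y ∈ A₂, (x ∈ χ ↔ y ∈ χ) := fun x hx y hy =>
    hA₂.mem_iff_mem_of_separatesAt (disjoint_left.2 fun z hz => (h₂ hz).2)
      (fun R hR => hχ R (h₂ hR).1) hx hy
  obtain ⟨a, haB, haχ⟩ := mem_closure_iff.1 ((hχ P hP).2 hPΓ).1 B hB hP
  obtain ⟨b, hbB, hbχ⟩ := mem_closure_iff.1 ((hχ P hP).2 hPΓ).2 B hB hP
  have ha : a ∈ A₁ ∪ A₂ := hA ▸ ⟨haB, haχ.2⟩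
  have hb : b ∈ A₁ ∪ A₂ := hA ▸ ⟨hbB, hbχ.2⟩
  rcases ha with ha | ha <;> rcases hb with hb | hb
  · exact absurd ((hc₁ a ha b hb).1 haχ.1) hbχ.1
  · exact .inl ⟨fun z hz => (hc₁ a ha z hz).1 haχ.1, fun z hz h => hbχ.1 ((hc₂ b hb z hz).2 h)⟩
  · exact .inr ⟨fun z hz h => hbχ.1 ((hc₁ b hb z hz).2 h), fun z hz => (hc₂ a ha z hz).1 haχ.1⟩
  · exact absurd ((hc₂ a ha b hb).1 haχ.1) hbχ.1

theorem LocallyTwoSided.eventually_agree_or (hs : LocallyTwoSided Γ) {U : Set X}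
    (hU : IsOpen U) (hχ : ∀ R ∈ U, SeparatesAt Γ χ R) (hχ' : ∀ R ∈ U, SeparatesAt Γ χ' R)
    {x : X} (hx : x ∈ U) :
    (∀ᶠ z in 𝓝 x, z ∉ Γ → (z ∈ χ ↔ z ∈ χ')) ∨ (∀ᶠ z in 𝓝 x, z ∉ Γ → (z ∈ χ ↔ z ∈ χ'ᶜ)) := by
  by_cases hxΓ : x ∈ Γ
  · obtain ⟨B, A₁, A₂, hB, hxB, hBU, hA, -, -, -, hA₁, hA₂, -, -⟩ := hs x hxΓ U (hU.mem_nhds hx)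
    have h₁ := sides_of_separatesAt hB hxB hxΓ hA hA₁ hA₂ fun R hR => hχ R (hBU hR)
    have h₂ := sides_of_separatesAt hB hxB hxΓ hA hA₁ hA₂ fun R hR => hχ' R (hBU hR)
    have key : (∀ z ∈ A₁ ∪ A₂, (z ∈ χ ↔ z ∈ χ')) ∨ (∀ z ∈ A₁ ∪ A₂, (z ∈ χ ↔ z ∈ χ'ᶜ)) := by
      simp only [subset_def, mem_compl_iff, mem_union] at *
      grind
    rw [← hA] at key
    refine key.imp (fun h => ?_) (fun h => ?_)
    all_goals
      filter_upwards [hB.mem_nhds hxB] with z hz hzΓ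
      exact h z ⟨hz, hzΓ⟩
  · have h₁ := (hχ x hx).1 hxΓ
    have h₂ := (hχ' x hx).1 hxΓ
    by_cases hc : x ∈ χ ↔ x ∈ χ'
    · left
      filter_upwards [h₁, h₂] with z h₁ h₂ _
      rw [h₁, h₂, hc]
    · right
      filter_upwards [h₁, h₂] with z h₁ h₂ _
      rw [h₁, mem_compl_iff, h₂]
      tauto

theorem LocallyTwoSided.mem_closure_compl (hs : LocallyTwoSided Γ) (x : X) : x ∈ closure Γᶜ := by
  by_cases hx : x ∈ Γ
  · obtain ⟨B, A₁, A₂, -, hxB, -, hA, -, -, -, -, -, h, -⟩ := hs x hx univ Filter.univ_mem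
    have hA₁ : A₁ ⊆ Γᶜ := fun z hz => (hA.ge (Or.inl hz) : z ∈ B \ Γ).2
    exact closure_mono hA₁ (h ⟨hxB, hx⟩)
  · exact subset_closure hx

theorem LocallyTwoSided.agree_of_eventually (hs : LocallyTwoSided Γ) {U : Set X}
    (hU : IsOpen U) (hUc : IsPreconnected U)
    (hχ : ∀ R ∈ U, SeparatesAt Γ χ R) (hχ' : ∀ R ∈ U, SeparatesAt Γ χ' R)
    {x : X} (hx : x ∈ U) (hxχ : ∀ᶠ z in 𝓝 x, z ∉ Γ → (z ∈ χ ↔ z ∈ χ')) {y : X} (hy : y ∈ U)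
    (hyΓ : y ∉ Γ) : y ∈ χ ↔ y ∈ χ' := by
  have key : x ∈ {x | ∀ᶠ z in 𝓝 x, z ∉ Γ → (z ∈ χ ↔ z ∈ χ')} ↔
      y ∈ {x | ∀ᶠ z in 𝓝 x, z ∉ Γ → (z ∈ χ ↔ z ∈ χ')} := by
    refine hUc.mem_iff_mem_of_eventually (fun p hp => ?_) hx hy
    refine Filter.Eventually.filter_mono nhdsWithin_le_nhds ?_
    rcases hs.eventually_agree_or hU hχ hχ' hp with h | h
    · filter_upwards [h.eventually_nhds] with q hq
      exact iff_of_true hq h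
    · have hno : ∀ q, (∀ᶠ z in 𝓝 q, z ∉ Γ → (z ∈ χ ↔ z ∈ χ'ᶜ)) →
          ¬ ∀ᶠ z in 𝓝 q, z ∉ Γ → (z ∈ χ ↔ z ∈ χ') := by
        intro q h₁ h₂
        obtain ⟨z, hz, hz₁, hz₂⟩ :=
          ((mem_closure_iff_frequently.1 (hs.mem_closure_compl q)).and_eventually
            (h₁.and h₂)).exists
        have := hz₁ hz
        have := hz₂ hz
        simp only [mem_compl_iff] at *
        tauto
      filter_upwards [h.eventually_nhds] with q hq
      exact iff_of_false (hno q hq) (hno p h)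
  exact (key.1 hxχ).self_of_nhds hyΓ

theorem LocallyTwoSided.exists_separatesAt_union (hΓ : IsClosed Γ) (hs : LocallyTwoSided Γ)
    {U V : Set X} (hU : IsOpen U) (hV : IsOpen V) (hUV : IsPreconnected (U ∩ V))
    (hχ : ∀ R ∈ U, SeparatesAt Γ χ R) (hχ' : ∀ R ∈ V, SeparatesAt Γ χ' R) :
    ∃ ψ : Set X, ∀ R ∈ U ∪ V, SeparatesAt Γ ψ R := by
  obtain ⟨φ, hφ, hagree⟩ : ∃ φ : Set X, (∀ R ∈ V, SeparatesAt Γ φ R) ∧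
      ∀ z ∈ U ∩ V, z ∉ Γ → (z ∈ χ ↔ z ∈ φ) := by
    rcases (U ∩ V).eq_empty_or_nonempty with h | ⟨x, hx⟩
    · exact ⟨χ', hχ', by simp [h]⟩
    · have hχ₀ : ∀ R ∈ U ∩ V, SeparatesAt Γ χ R := fun R hR => hχ R hR.1
      rcases hs.eventually_agree_or (hU.inter hV) hχ₀ (fun R hR => hχ' R hR.2) hx with h | h
      · exact ⟨χ', hχ', fun z => hs.agree_of_eventually (hU.inter hV) hUV hχ₀
          (fun R hR => hχ' R hR.2) hx h⟩
      · exact ⟨χ'ᶜ, fun R hR => (hχ' R hR).compl, fun z =>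
          hs.agree_of_eventually (hU.inter hV) hUV hχ₀ (fun R hR => (hχ' R hR.2).compl) hx h⟩
  refine ⟨{z | (z ∈ U ∧ z ∈ χ) ∨ (z ∉ U ∧ z ∈ φ)}, ?_⟩
  rintro R (hR | hR)
  · refine (hχ R hR).congr hΓ ?_
    filter_upwards [hU.mem_nhds hR] with z hz _
    simp [hz]
  · refine (hφ R hR).congr hΓ ?_
    filter_upwards [hV.mem_nhds hR] with z hz hzΓ
    by_cases hzU : z ∈ U
    · simp [hzU, hagree z ⟨hzU, hz⟩ hzΓ]
    · simp [hzU]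

theorem LocallyTwoSided.exists_separatesAt_nhds (hΓ : IsClosed Γ) (hs : LocallyTwoSided Γ) (P : X) :
    ∃ U : Set X, IsOpen U ∧ P ∈ U ∧ ∃ χ : Set X, ∀ R ∈ U, SeparatesAt Γ χ R := by
  by_cases hP : P ∈ Γ
  · obtain ⟨B, A₁, A₂, hB, hPB, -, hA, hd, ho₁, ho₂, -, -, hc₁, hc₂⟩ := hs P hP univ Filter.univ_mem
    have hA₁ : A₁ ⊆ B \ Γ := hA ▸ subset_union_left
    have hA₂ : A₂ ⊆ B \ Γ := hA ▸ subset_union_right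
    refine ⟨B, hB, hPB, A₁, fun R hR => ⟨fun hRΓ => ?_, fun hRΓ => ⟨?_, ?_⟩⟩⟩
    · have hR' : R ∈ A₁ ∪ A₂ := hA ▸ ⟨hR, hRΓ⟩
      rcases hR' with h | h
      · filter_upwards [ho₁.mem_nhds h] with y hy
        exact iff_of_true hy h
      · filter_upwards [ho₂.mem_nhds h] with y hy
        exact iff_of_false (hd.notMem_of_mem_right hy) (hd.notMem_of_mem_right h)
    · have hsub : A₁ ⊆ A₁ \ Γ := fun z hz => ⟨hz, (hA₁ hz).2⟩
      exact closure_mono hsub (hc₁ ⟨hR, hRΓ⟩)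
    · have hsub : A₂ ⊆ A₁ᶜ \ Γ := fun z hz => ⟨hd.notMem_of_mem_right hz, (hA₂ hz).2⟩
      exact closure_mono hsub (hc₂ ⟨hR, hRΓ⟩)
  · exact ⟨Γᶜ, hΓ.isOpen_compl, hP, univ, fun R hR =>
      ⟨fun _ => by simp, fun h => absurd h hR⟩⟩

end Topological

section Normed

variable {E : Type*} [NormedAddCommGroup E] [NormedSpace ℝ E] {Γ : Set E}

theorem LocallyTwoSided.exists_separatesAt_thickening (hΓ : IsClosed Γ) (hs : LocallyTwoSided Γ)
    (x : E) : ∃ δ > 0, ∃ χ : Set E, ∀ R ∈ thickening δ ((fun s : ℝ => s • x) '' Icc 0 1),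
      SeparatesAt Γ χ R := by
  choose U hUo hU χ hχ using hs.exists_separatesAt_nhds hΓ
  obtain ⟨δ, hδ, hball⟩ := lebesgue_number_lemma_of_metric
    (isCompact_Icc.image (by fun_prop : Continuous fun s : ℝ => s • x) : IsCompact
      ((fun s : ℝ => s • x) '' Icc 0 1)) hUo (fun p _ => mem_iUnion.2 ⟨p, hU p⟩)
  obtain ⟨N, hN⟩ := exists_nat_gt (‖x‖ / (δ / 2))
  have hNpos : (0 : ℝ) < N := lt_of_le_of_lt (by positivity) hN
  have hstep : 1 / (N : ℝ) * ‖x‖ < δ / 2 := by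
    rw [div_lt_iff₀ (by positivity)] at hN
    field_simp
    linarith
  have main : ∀ k : ℕ, k ≤ N → ∃ χ : Set E,
      ∀ R ∈ thickening (δ / 2) ((fun s : ℝ => s • x) '' Icc 0 ((k : ℝ) / N)),
        SeparatesAt Γ χ R := by
    intro k
    induction k with
    | zero =>
      intro _
      obtain ⟨i, hi⟩ := hball 0 ⟨0, by simp, by simp⟩
      refine ⟨χ i, fun R hR => hχ i R (hi ?_)⟩
      simp only [Nat.cast_zero, zero_div, Icc_self, image_singleton, zero_smul,
        thickening_singleton] at hR
      exact ball_subset_ball (by linarith) hR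
    | succ k ih =>
      intro hk
      obtain ⟨χ₁, hχ₁⟩ := ih (by omega)
      have hkN : (k : ℝ) / N ≤ 1 := by
        rw [div_le_one hNpos]
        exact_mod_cast (by omega : k ≤ N)
      obtain ⟨i, hi⟩ := hball (((k : ℝ) / N) • x) ⟨(k : ℝ) / N, ⟨by positivity, hkN⟩, rfl⟩
      have hconv : Convex ℝ (thickening (δ / 2) ((fun s : ℝ => s • x) '' Icc 0 ((k : ℝ) / N))) :=
        ((convex_Icc _ _).is_linear_image
          (LinearMap.isLinear (LinearMap.toSpanSingleton ℝ E x))).thickening _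
      obtain ⟨ψ, hψ⟩ := hs.exists_separatesAt_union hΓ isOpen_thickening
        (isOpen_ball (x := ((k : ℝ) / N) • x) (ε := δ))
        (hconv.inter (convex_ball _ _)).isPreconnected hχ₁ (fun R hR => hχ i R (hi hR))
      refine ⟨ψ, fun R hR => hψ R ?_⟩
      obtain ⟨_, ⟨s, hs, rfl⟩, hd⟩ := mem_thickening_iff.1 hR
      by_cases hsk : s ≤ (k : ℝ) / N
      · exact .inl (mem_thickening_iff.2 ⟨_, ⟨s, ⟨hs.1, hsk⟩, rfl⟩, hd⟩)
      · right
        have h₁ : dist (s • x) (((k : ℝ) / N) • x) ≤ 1 / (N : ℝ) * ‖x‖ := by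
          rw [dist_eq_norm, ← sub_smul, norm_smul, Real.norm_eq_abs, abs_of_pos (by linarith)]
          gcongr
          have := hs.2
          push_cast at this
          rw [add_div] at this
          linarith
        have := dist_triangle R (s • x) (((k : ℝ) / N) • x)
        simp only [mem_ball] at *
        linarith
  obtain ⟨χ₀, h₀⟩ := main N le_rfl
  rw [div_self hNpos.ne'] at h₀
  exact ⟨δ / 2, by positivity, χ₀, h₀⟩

theorem LocallyTwoSided.exists_separatesAt (hΓ : IsClosed Γ) (hs : LocallyTwoSided Γ) :
    ∃ χ : Set E, ∀ R, SeparatesAt Γ χ R := by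
  choose δ hδ χ hχ using hs.exists_separatesAt_thickening hΓ
  set U : E → Set E := fun x => thickening (δ x) ((fun s : ℝ => s • x) '' Icc 0 1) with hUdef
  have hU₀ : ∀ x, (0 : E) ∈ U x := fun x =>
    self_subset_thickening (hδ x) _ ⟨0, by simp, by simp⟩
  have hU₁ : ∀ x, x ∈ U x := fun x =>
    self_subset_thickening (hδ x) _ ⟨1, by simp, by simp⟩
  have hUo : ∀ x, IsOpen (U x) := fun x => isOpen_thickening
  have hUc : ∀ x, Convex ℝ (U x) := fun x => ((convex_Icc _ _).is_linear_image
    (LinearMap.isLinear (LinearMap.toSpanSingleton ℝ E x))).thickening _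
  have hφ : ∀ x, ∃ φ : Set E, (∀ R ∈ U x, SeparatesAt Γ φ R) ∧
      ∀ᶠ z in 𝓝 (0 : E), z ∉ Γ → (z ∈ φ ↔ z ∈ χ 0) := by
    intro x
    rcases hs.eventually_agree_or ((hUo 0).inter (hUo x)) (fun R hR => hχ 0 R hR.1)
      (fun R hR => hχ x R hR.2) ⟨hU₀ 0, hU₀ x⟩ with h | h
    · exact ⟨χ x, hχ x, h.mono fun z hz hzΓ => (hz hzΓ).symm⟩
    · exact ⟨(χ x)ᶜ, fun R hR => (hχ x R hR).compl, h.mono fun z hz hzΓ => (hz hzΓ).symm⟩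
  choose φ hφ hφ₀ using hφ
  have hagree : ∀ x y z, z ∈ U x → z ∈ U y → z ∉ Γ → (z ∈ φ x ↔ z ∈ φ y) := by
    intro x y z hx hy hz
    refine hs.agree_of_eventually ((hUo x).inter (hUo y))
      ((hUc x).inter (hUc y)).isPreconnected (fun R hR => hφ x R hR.1)
      (fun R hR => hφ y R hR.2) ⟨hU₀ x, hU₀ y⟩ ?_ ⟨hx, hy⟩ hz
    filter_upwards [hφ₀ x, hφ₀ y] with w h₁ h₂ hw
    rw [h₁ hw, h₂ hw]
  refine ⟨{z | z ∈ φ z}, fun R => (hφ R R (hU₁ R)).congr hΓ ?_⟩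
  filter_upwards [(hUo R).mem_nhds (hU₁ R)] with z hz hzΓ
  exact hagree R z z hz (hU₁ z) hzΓ

/-- A set separating the two sides of a connected locally two-sided closed set `Γ` identifies the
connected components of the complement of `Γ`. -/
theorem LocallyTwoSided.connectedComponentIn_eq_iff (hΓ : IsClosed Γ) (hs : LocallyTwoSided Γ)
    (hne : Γ.Nonempty) (hconn : IsPreconnected Γ) {χ : Set E} (hχ : ∀ R, SeparatesAt Γ χ R)
    {x y : E} (hx : x ∉ Γ) (hy : y ∉ Γ) :
    connectedComponentIn Γᶜ x = connectedComponentIn Γᶜ y ↔ (x ∈ χ ↔ y ∈ χ) := by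
  have hmem : ∀ {z}, z ∉ Γ → z ∈ connectedComponentIn Γᶜ z := fun hz =>
    mem_connectedComponentIn hz
  constructor
  · intro h
    exact isPreconnected_connectedComponentIn.mem_iff_mem_of_separatesAt
      (disjoint_left.2 fun z hz => connectedComponentIn_subset Γᶜ y hz) (fun R _ => hχ R)
      (h ▸ hmem hx) (hmem hy)
  · intro hxy
    have hadh : ∀ z, z ∉ Γ → Γ ⊆ closure (connectedComponentIn Γᶜ z) := by
      intro z hz
      set K := connectedComponentIn Γᶜ z with hK
      have hKo : IsOpen K := hΓ.isOpen_compl.connectedComponentIn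
      obtain ⟨P, hPΓ, hPK⟩ : ∃ P ∈ Γ, P ∈ closure K := by
        by_contra! hcon
        have hcl : closure K ⊆ K :=
          isPreconnected_connectedComponentIn.closure.subset_connectedComponentIn
            (subset_closure (hmem hz)) fun w hw hwΓ => hcon w hwΓ hw
        have huniv : K = univ := IsClopen.eq_univ ⟨isClosed_of_closure_subset hcl, hKo⟩ ⟨z, hmem hz⟩
        obtain ⟨P, hP⟩ := hne
        exact connectedComponentIn_subset Γᶜ z (huniv ▸ mem_univ P : P ∈ K) hP
      intro Q hQ
      refine (hconn.mem_iff_mem_of_eventually (fun R hR => ?_) hPΓ hQ).1 hPK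
      obtain ⟨B, A₁, A₂, hB, hRB, -, hA, -, -, -, hA₁, hA₂, hc₁, hc₂⟩ :=
        hs R hR univ Filter.univ_mem
      have hsub : ∀ {A : Set E}, IsPreconnected A → A ⊆ B \ Γ → (A ∩ K).Nonempty → A ⊆ K := by
        rintro A hA hAB ⟨w, hwA, hwK⟩
        rw [hK, connectedComponentIn_eq hwK]
        exact hA.subset_connectedComponentIn hwA fun v hv => (hAB hv).2
      have hall : ∀ Q ∈ B ∩ Γ, Q ∈ closure K → ∀ Q' ∈ B ∩ Γ, Q' ∈ closure K := by
        intro Q hQ hQK Q' hQ'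
        obtain ⟨w, hwB, hwK⟩ := mem_closure_iff.1 hQK B hB hQ.1
        have hw : w ∈ A₁ ∪ A₂ := hA ▸ ⟨hwB, connectedComponentIn_subset Γᶜ z hwK⟩
        rcases hw with hw | hw
        · exact closure_mono (hsub hA₁ (hA ▸ subset_union_left) ⟨w, hw, hwK⟩) (hc₁ hQ')
        · exact closure_mono (hsub hA₂ (hA ▸ subset_union_right) ⟨w, hw, hwK⟩) (hc₂ hQ')
      filter_upwards [self_mem_nhdsWithin, nhdsWithin_le_nhds (hB.mem_nhds hRB)] with Q hQΓ hQB
      exact ⟨fun h => hall Q ⟨hQB, hQΓ⟩ h R ⟨hRB, hR⟩, fun h => hall R ⟨hRB, hR⟩ h Q ⟨hQB, hQΓ⟩⟩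
    obtain ⟨P, hP⟩ := hne
    obtain ⟨B, A₁, A₂, hB, hPB, -, hA, -, -, -, hA₁, hA₂, -, -⟩ :=
      hs P hP univ Filter.univ_mem
    have hside := sides_of_separatesAt hB hPB hP hA hA₁ hA₂ fun R _ => hχ R
    have hloc : ∀ z, z ∉ Γ → ∃ w ∈ A₁ ∪ A₂, connectedComponentIn Γᶜ z = connectedComponentIn Γᶜ w ∧
        (z ∈ χ ↔ w ∈ χ) := by
      intro z hz
      obtain ⟨w, hwB, hwK⟩ := mem_closure_iff.1 (hadh z hz hP) B hB hPB
      exact ⟨w, hA ▸ ⟨hwB, connectedComponentIn_subset Γᶜ z hwK⟩, connectedComponentIn_eq hwK,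
        isPreconnected_connectedComponentIn.mem_iff_mem_of_separatesAt
          (disjoint_left.2 fun v hv => connectedComponentIn_subset Γᶜ z hv) (fun R _ => hχ R)
          (hmem hz) hwK⟩
    obtain ⟨x', hx', hxx, hxχ⟩ := hloc x hx
    obtain ⟨y', hy', hyy, hyχ⟩ := hloc y hy
    have hjoin : ∀ {A : Set E}, IsPreconnected A → A ⊆ B \ Γ → x' ∈ A → y' ∈ A →
        connectedComponentIn Γᶜ x' = connectedComponentIn Γᶜ y' := fun hA hAB h₁ h₂ =>
      connectedComponentIn_eq (hA.subset_connectedComponentIn h₁ (fun v hv => (hAB hv).2) h₂)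
    rw [hxx, hyy]
    have hsame : (x' ∈ A₁ ∧ y' ∈ A₁) ∨ (x' ∈ A₂ ∧ y' ∈ A₂) := by
      simp only [subset_def, mem_compl_iff, mem_union] at *
      grind
    rcases hsame with h | h
    · exact hjoin hA₁ (hA ▸ subset_union_left) h.1 h.2
    · exact hjoin hA₂ (hA ▸ subset_union_right) h.1 h.2

end Normed

end Separation

section Rays

open Topology Metric

variable {E : Type*} [NormedAddCommGroup E] [NormedSpace ℝ E] {Γ : Set E} {P u v : E}

/-- Near `P`, the set `Γ` is the union of the rays from `P` in the directions `u` and `v`. -/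
def IsLocallyTwoRays (Γ : Set E) (P u v : E) : Prop :=
  ∀ᶠ x in 𝓝 P, (x ∈ Γ ↔ ∃ t : ℝ, 0 ≤ t ∧ (x = P + t • u ∨ x = P + t • v))

theorem tendsto_add_smul_nhdsGT (R w : E) :
    Filter.Tendsto (fun h : ℝ => R + h • w) (𝓝[>] 0) (𝓝 R) := by
  have : Filter.Tendsto (fun h : ℝ => R + h • w) (𝓝 0) (𝓝 (R + (0 : ℝ) • w)) :=
    Continuous.tendsto (by fun_prop) 0
  rw [zero_smul, add_zero] at this
  exact this.mono_left nhdsWithin_le_nhds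

theorem mem_closure_ball_inter {R w : E} {r : ℝ} {A : Set E} (hR : R ∈ ball P r)
    (hw : ∀ h : ℝ, 0 < h → R + h • w ∈ A) : R ∈ closure (ball P r ∩ A) := by
  refine mem_closure_of_tendsto (tendsto_add_smul_nhdsGT R w) ?_
  filter_upwards [(tendsto_add_smul_nhdsGT R w).eventually (isOpen_ball.mem_nhds hR),
    self_mem_nhdsWithin] with h h₁ h₂
  exact ⟨h₁, hw h h₂⟩

theorem convex_ball_inter_pos (f : E →L[ℝ] ℝ) (P : E) (r : ℝ) :
    Convex ℝ (ball P r ∩ {x | 0 < f (x - P)}) := by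
  simp only [map_sub, sub_pos]
  exact (convex_ball P r).inter (convex_halfSpace_gt f.isLinear _)

theorem convex_ball_inter_neg (f : E →L[ℝ] ℝ) (P : E) (r : ℝ) :
    Convex ℝ (ball P r ∩ {x | f (x - P) < 0}) := by
  simp only [map_sub, sub_neg]
  exact (convex_ball P r).inter (convex_halfSpace_lt f.isLinear _)

theorem exists_coordinates (hE : Module.finrank ℝ E = 2) (h : LinearIndependent ℝ ![u, v]) :
    ∃ α β : E →L[ℝ] ℝ, α u = 1 ∧ α v = 0 ∧ β u = 0 ∧ β v = 1 ∧
      ∀ x, x = α x • u + β x • v := by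
  have : FiniteDimensional ℝ E := .of_finrank_pos (by omega)
  set b := basisOfLinearIndependentOfCardEqFinrank h (by simp [hE]) with hb
  have hb₀ : b 0 = u := by simp [hb]
  have hb₁ : b 1 = v := by simp [hb]
  refine ⟨(b.coord 0).toContinuousLinearMap, (b.coord 1).toContinuousLinearMap,
    ?_, ?_, ?_, ?_, fun x => ?_⟩
  · simp [← hb₀]
  · simp [← hb₁]
  · simp [← hb₀]
  · simp [← hb₁]
  · have := b.sum_repr x
    rw [Fin.sum_univ_two, hb₀, hb₁] at this
    exact this.symm

theorem diff_eq_of_line {r : ℝ} {f : E →L[ℝ] ℝ} (hf : ∀ x ∈ ball P r, (x ∈ Γ ↔ f (x - P) = 0)) :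
    ball P r \ Γ = (ball P r ∩ {x | 0 < f (x - P)}) ∪ (ball P r ∩ {x | f (x - P) < 0}) := by
  ext x
  rw [← inter_union_distrib_left, mem_sdiff, mem_inter_iff]
  refine and_congr_right fun hx => ?_
  rw [hf x hx, mem_union, mem_ofPred_eq, mem_ofPred_eq, ← ne_eq, ne_iff_lt_or_gt]
  exact or_comm

theorem IsLocallyTwoRays.exists_functional (hE : Module.finrank ℝ E = 2)
    (h : IsLocallyTwoRays Γ P u (-u)) (hv : LinearIndependent ℝ ![u, v]) :
    ∃ f : E →L[ℝ] ℝ, f v = 1 ∧ ∀ᶠ x in 𝓝 P, (x ∈ Γ ↔ f (x - P) = 0) := by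
  obtain ⟨α, β, -, -, hβu, hβv, hx⟩ := exists_coordinates hE hv
  refine ⟨β, hβv, h.mono fun x hxΓ => hxΓ.trans ⟨?_, fun hβ => ?_⟩⟩
  · rintro ⟨t, -, rfl | rfl⟩ <;> simp [hβu]
  · have := hx (x - P)
    rw [hβ, zero_smul, add_zero, sub_eq_iff_eq_add'] at this
    rcases le_total 0 (α (x - P)) with h₀ | h₀
    · exact ⟨_, h₀, .inl this⟩
    · exact ⟨-α (x - P), by linarith, .inr (by rwa [neg_smul_neg])⟩

theorem locallyTwoSided_of_isLocallyTwoRays (hE : Module.finrank ℝ E = 2)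
    (h : ∀ P ∈ Γ, ∃ u v : E, ‖u‖ = 1 ∧ ‖v‖ = 1 ∧ u ≠ v ∧ IsLocallyTwoRays Γ P u v) :
    LocallyTwoSided Γ := by
  intro P hP U hU
  obtain ⟨u, v, hu, hv, huv, hrays⟩ := h P hP
  have hu₀ : u ≠ 0 := by
    rintro rfl
    simp at hu
  have hdisj : ∀ {s t : Set E}, (∀ x, x ∈ s → x ∉ t) → Disjoint s t := disjoint_left.2
  have hcont : ∀ f : E →L[ℝ] ℝ, Continuous fun x => f (x - P) := fun f => by fun_prop
  have hPB : ∀ {r : ℝ}, 0 < r → P ∈ ball P r := mem_ball_self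
  by_cases hli : LinearIndependent ℝ ![u, v]
  · obtain ⟨α, β, hαu, hαv, hβu, hβv, hx⟩ := exists_coordinates hE hli
    have hcoord : ∀ᶠ x in 𝓝 P, (x ∈ Γ ↔ (0 ≤ α (x - P) ∧ β (x - P) = 0) ∨
        (α (x - P) = 0 ∧ 0 ≤ β (x - P))) := by
      refine hrays.mono fun x hxΓ => hxΓ.trans ⟨?_, ?_⟩
      · rintro ⟨t, ht, rfl | rfl⟩ <;> simp [hβu, hβv, hαu, hαv, ht]
      · have := hx (x - P)
        rintro (⟨h₁, h₂⟩ | ⟨h₁, h₂⟩)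
        · rw [h₂, zero_smul, add_zero, sub_eq_iff_eq_add'] at this
          exact ⟨_, h₁, .inl this⟩
        · rw [h₁, zero_smul, zero_add, sub_eq_iff_eq_add'] at this
          exact ⟨_, h₂, .inr this⟩
    obtain ⟨r, hr, hball⟩ := Metric.mem_nhds_iff.1 (Filter.inter_mem hU hcoord)
    refine ⟨ball P r, ball P r ∩ {x | 0 < α (x - P) ∧ 0 < β (x - P)},
      ball P r ∩ {x | α (x - P) < 0 ∨ β (x - P) < 0}, isOpen_ball, hPB hr,
      fun x hx => (hball hx).1, ?_, ?_, ?_, ?_, ?_, ?_, ?_, ?_⟩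
    · ext x
      rw [← inter_union_distrib_left, mem_sdiff, mem_inter_iff]
      refine and_congr_right fun hx => ?_
      refine (not_congr (hball hx).2).trans ?_
      simp only [mem_union, mem_ofPred_eq]
      grind
    · refine hdisj fun x hx hx' => ?_
      rcases hx'.2 with h | h <;> linarith [hx.2.1, hx.2.2]
    · exact isOpen_ball.inter ((isOpen_lt continuous_const (hcont α)).inter
        (isOpen_lt continuous_const (hcont β)))
    · exact isOpen_ball.inter ((isOpen_lt (hcont α) continuous_const).union
        (isOpen_lt (hcont β) continuous_const))
    · have : ball P r ∩ {x | 0 < α (x - P) ∧ 0 < β (x - P)} =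
          (ball P r ∩ {x | 0 < α (x - P)}) ∩ (ball P r ∩ {x | 0 < β (x - P)}) := by
        rw [← inter_inter_distrib_left]
        rfl
      rw [this]
      exact ((convex_ball_inter_pos α P r).inter (convex_ball_inter_pos β P r)).isPreconnected
    · have : ball P r ∩ {x | α (x - P) < 0 ∨ β (x - P) < 0} =
          (ball P r ∩ {x | α (x - P) < 0}) ∪ (ball P r ∩ {x | β (x - P) < 0}) := by
        rw [← inter_union_distrib_left]
        rfl
      rw [this]
      refine IsPreconnected.union' ?_ (convex_ball_inter_neg α P r).isPreconnected
        (convex_ball_inter_neg β P r).isPreconnected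
      have hcl : P ∈ closure (ball P r ∩ ({x | α (x - P) < 0} ∩ {x | β (x - P) < 0})) := by
        refine mem_closure_ball_inter (w := -(u + v)) (hPB hr) fun h hh => ?_
        simp [hαu, hαv, hβu, hβv, hh]
      obtain ⟨x, hx⟩ := closure_nonempty_iff.1 ⟨P, hcl⟩
      exact ⟨x, ⟨hx.1, hx.2.1⟩, hx.1, hx.2.2⟩
    · rintro R ⟨hR, hRΓ⟩
      have hRΓ := (hball hR).2.1 hRΓ
      refine mem_closure_ball_inter (w := u + v) hR fun h hh => ?_
      simp only [mem_ofPred_eq, add_sub_right_comm R, map_add, map_smul, hαu, hαv, hβu, hβv,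
        smul_eq_mul]
      constructor <;> rcases hRΓ with h | h <;> linarith [h.1, h.2]
    · rintro R ⟨hR, hRΓ⟩
      have hRΓ := (hball hR).2.1 hRΓ
      refine mem_closure_ball_inter (w := -(u + v)) hR fun h hh => ?_
      simp only [mem_ofPred_eq, add_sub_right_comm R, map_add, map_smul, hαu, hαv, hβu, hβv,
        smul_eq_mul, map_neg]
      rcases hRΓ with h | h
      · right
        linarith [h.2]
      · left
        linarith [h.1]
  · have hvu : v = -u := by
      rw [LinearIndependent.pair_iff' hu₀] at hli
      push Not at hli
      obtain ⟨a, rfl⟩ := hli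
      rw [norm_smul, hu, mul_one, Real.norm_eq_abs] at hv
      rcases eq_or_eq_neg_of_abs_eq hv with rfl | rfl
      · simp at huv
      · simp
    subst hvu
    obtain ⟨n, hn⟩ : ∃ n : E, LinearIndependent ℝ ![u, n] := by
      by_contra! hcon
      simp only [LinearIndependent.pair_iff' hu₀] at hcon
      push Not at hcon
      have := finrank_le_one u hcon
      omega
    obtain ⟨f, hfn, hf⟩ := hrays.exists_functional hE hn
    obtain ⟨r, hr, hball⟩ := Metric.mem_nhds_iff.1 (Filter.inter_mem hU hf)
    refine ⟨ball P r, _, _, isOpen_ball, hPB hr, fun x hx => (hball hx).1,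
      diff_eq_of_line fun x hx => (hball hx).2, ?_, ?_, ?_,
      (convex_ball_inter_pos f P r).isPreconnected,
      (convex_ball_inter_neg f P r).isPreconnected, ?_, ?_⟩
    · exact hdisj fun x hx hx' => lt_asymm (show 0 < f (x - P) from hx.2) hx'.2
    · exact isOpen_ball.inter (isOpen_lt continuous_const (hcont f))
    · exact isOpen_ball.inter (isOpen_lt (hcont f) continuous_const)
    · rintro R ⟨hR, hRΓ⟩
      have hRΓ : f (R - P) = 0 := (hball hR).2.1 hRΓ
      refine mem_closure_ball_inter (w := n) hR fun h hh => ?_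
      simp only [mem_ofPred_eq, add_sub_right_comm R, map_add, map_smul, hfn, hRΓ]
      simpa using hh
    · rintro R ⟨hR, hRΓ⟩
      have hRΓ : f (R - P) = 0 := (hball hR).2.1 hRΓ
      refine mem_closure_ball_inter (w := -n) hR fun h hh => ?_
      simp only [mem_ofPred_eq, add_sub_right_comm R, map_add, map_smul, map_neg, hfn, hRΓ]
      simpa using hh

/-- A set separating the two sides of `Γ` changes across `Γ` along a transversal direction. -/
theorem IsLocallyTwoRays.eventually_not_iff (hE : Module.finrank ℝ E = 2)
    (h : IsLocallyTwoRays Γ P u (-u)) (hv : LinearIndependent ℝ ![u, v]) (hP : P ∈ Γ) {χ : Set E}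
    (hχ : ∀ R, SeparatesAt Γ χ R) :
    ∀ᶠ h in 𝓝[>] (0 : ℝ), ¬ (P - h • v ∈ χ ↔ P + h • v ∈ χ) := by
  obtain ⟨f, hfv, hf⟩ := h.exists_functional hE hv
  obtain ⟨r, hr, hball⟩ := Metric.mem_nhds_iff.1 hf
  have hside := sides_of_separatesAt isOpen_ball (mem_ball_self hr) hP
    (diff_eq_of_line fun x hx => hball hx) (convex_ball_inter_pos f P r).isPreconnected
    (convex_ball_inter_neg f P r).isPreconnected fun R _ => hχ R
  filter_upwards [(tendsto_add_smul_nhdsGT P v).eventually (ball_mem_nhds P hr),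
    (tendsto_add_smul_nhdsGT P (-v)).eventually (ball_mem_nhds P hr),
    self_mem_nhdsWithin] with h h₁ h₂ h₃
  rw [smul_neg, ← sub_eq_add_neg] at h₂
  have h₃ : 0 < h := h₃
  have hpos : P + h • v ∈ ball P r ∩ {x | 0 < f (x - P)} := ⟨h₁, by simp [hfv, h₃]⟩
  have hneg : P - h • v ∈ ball P r ∩ {x | f (x - P) < 0} := ⟨h₂, by simp [hfv, h₃]⟩
  rcases hside with hs | hs
  · exact fun hc => hs.2 hneg (hc.2 (hs.1 hpos))
  · exact fun hc => hs.1 hpos (hc.1 (hs.2 hneg))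

end Rays

section Polygon

open Topology Metric

variable {E : Type*} [NormedAddCommGroup E] [NormedSpace ℝ E] {Γ : Set E} {P u v : E}

theorem exists_directions_segment (a b P : E) :
    ∃ D : Set E, D.Finite ∧ (∀ u ∈ D, ‖u‖ = 1) ∧
      ∀ᶠ x in 𝓝 P, (x ∈ segment ℝ a b ∧ x ≠ P ↔ ∃ u ∈ D, ∃ t : ℝ, 0 < t ∧ x = P + t • u) := by
  by_cases hP : P ∈ segment ℝ a b
  · have hdir : ∀ {w x : E} {c : ℝ}, 0 < c → w ≠ P → x - P = c • (w - P) →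
        x = P + (c * ‖w - P‖) • (‖w - P‖⁻¹ • (w - P)) := by
      intro w x c _ hw hx
      have : ‖w - P‖ ≠ 0 := norm_ne_zero_iff.2 (sub_ne_zero.2 hw)
      rw [smul_smul, mul_assoc, mul_inv_cancel₀ this, mul_one, ← hx, add_sub_cancel]
    have hnorm : ∀ w, w ≠ P → 0 < ‖w - P‖ := fun w hw => norm_pos_iff.2 (sub_ne_zero.2 hw)
    refine ⟨(fun w => ‖w - P‖⁻¹ • (w - P)) '' ({a, b} \ {P}),
      ((Set.toFinite {a, b}).subset sdiff_subset).image _, ?_, ?_⟩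
    · rintro _ ⟨w, ⟨-, hw⟩, rfl⟩
      rw [norm_smul, norm_inv, norm_norm, inv_mul_cancel₀ (hnorm w hw).ne']
    · have hsmall : ∀ w : E, ∀ᶠ x in 𝓝 P, w ≠ P → dist x P < ‖w - P‖ := by
        intro w
        by_cases hw : w = P
        · simp [hw]
        · filter_upwards [ball_mem_nhds P (hnorm w hw)] with x hx _ using hx
      filter_upwards [hsmall a, hsmall b] with x hxa hxb
      constructor
      · rintro ⟨hx, hxP⟩
        rw [segment_eq_image'] at hP hx
        obtain ⟨θ, ⟨hθ₀, hθ₁⟩, rfl⟩ := hP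
        obtain ⟨τ, ⟨hτ₀, hτ₁⟩, rfl⟩ := hx
        dsimp only at *
        rcases lt_trichotomy τ θ with h | rfl | h
        · have hθ : 0 < θ := by linarith
          have hab : b - a ≠ 0 := fun h => hxP (by simp [h])
          have ha : a ≠ a + θ • (b - a) := by simpa [hθ.ne'] using hab
          have hc : 0 < (θ - τ) / θ := div_pos (by linarith) hθ
          refine ⟨_, ⟨a, ⟨by simp, ha⟩, rfl⟩, _, mul_pos hc (hnorm _ ha), hdir hc ha ?_⟩
          rw [show a - (a + θ • (b - a)) = (-θ) • (b - a) by module, smul_smul,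
            show (θ - τ) / θ * -θ = τ - θ by field_simp; ring]
          module
        · exact absurd rfl hxP
        · have hθ : 0 < 1 - θ := by linarith
          have hab : b - a ≠ 0 := fun h => hxP (by simp [h])
          have hbe : b - (a + θ • (b - a)) = (1 - θ) • (b - a) := by module
          have hb : b ≠ a + θ • (b - a) := by
            rw [← sub_ne_zero, hbe]
            exact smul_ne_zero hθ.ne' hab
          have hc : 0 < (τ - θ) / (1 - θ) := div_pos (by linarith) hθ
          refine ⟨_, ⟨b, ⟨by simp, hb⟩, rfl⟩, _, mul_pos hc (hnorm _ hb), hdir hc hb ?_⟩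
          rw [hbe, smul_smul, div_mul_cancel₀ _ hθ.ne']
          module
      · rintro ⟨_, ⟨w, ⟨hw, hwP⟩, rfl⟩, t, ht, rfl⟩
        have hwP : w ≠ P := hwP
        have hw₀ := hnorm w hwP
        have hu : ‖‖w - P‖⁻¹ • (w - P)‖ = 1 := by
          rw [norm_smul, norm_inv, norm_norm, inv_mul_cancel₀ hw₀.ne']
        have hdist : dist (P + t • (‖w - P‖⁻¹ • (w - P))) P = t := by
          rw [dist_eq_norm, add_sub_cancel_left, norm_smul, hu, mul_one, Real.norm_eq_abs,
            abs_of_pos ht]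
        rw [hdist] at hxa hxb
        have hlt : t < ‖w - P‖ := by
          rcases hw with rfl | rfl
          · exact hxa hwP
          · exact hxb hwP
        have hwab : w ∈ segment ℝ a b := by
          rcases hw with rfl | rfl
          · exact left_mem_segment ℝ _ _
          · exact right_mem_segment ℝ _ _
        refine ⟨(convex_segment a b).segment_subset hP hwab ?_, fun h => ?_⟩
        · rw [segment_eq_image']
          refine ⟨t * ‖w - P‖⁻¹, ⟨by positivity, ?_⟩, by simp only [smul_smul]⟩
          rw [← div_eq_mul_inv, div_le_one hw₀]
          exact hlt.le
        · rw [h, dist_self] at hdist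
          exact ht.ne hdist
  · refine ⟨∅, finite_empty, by simp, ?_⟩
    have hcl : IsClosed (segment ℝ a b) := by
      rw [segment_eq_image']
      exact (isCompact_Icc.image (by fun_prop)).isClosed
    filter_upwards [hcl.isOpen_compl.mem_nhds hP] with x hx
    simp only [mem_empty_iff_false, false_and, exists_false, iff_false]
    exact fun h => hx h.1

theorem exists_directions_iUnion_segment {ι : Type*} (s : Finset ι) (a b : ι → E) (P : E) :
    ∃ D : Set E, D.Finite ∧ (∀ u ∈ D, ‖u‖ = 1) ∧
      ∀ᶠ x in 𝓝 P, (x ∈ ⋃ k ∈ s, segment ℝ (a k) (b k)) ∧ x ≠ P ↔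
        ∃ u ∈ D, ∃ t : ℝ, 0 < t ∧ x = P + t • u := by
  choose D hfin hnorm hD using fun k => exists_directions_segment (a k) (b k) P
  refine ⟨⋃ k ∈ s, D k, s.finite_toSet.biUnion fun k _ => hfin k, ?_, ?_⟩
  · simp only [mem_iUnion]
    rintro u ⟨k, -, hu⟩
    exact hnorm k u hu
  · filter_upwards [(Filter.eventually_all_finset s).2 fun k _ => hD k] with x hx
    simp only [mem_iUnion, exists_prop]
    constructor
    · rintro ⟨⟨k, hk, hxk⟩, hxP⟩
      obtain ⟨u, hu, h⟩ := (hx k hk).1 ⟨hxk, hxP⟩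
      exact ⟨u, ⟨k, hk, hu⟩, h⟩
    · rintro ⟨u, ⟨k, hk, hu⟩, h⟩
      obtain ⟨h₁, h₂⟩ := (hx k hk).2 ⟨u, hu, h⟩
      exact ⟨⟨k, hk, h₁⟩, h₂⟩

/-- A simple closed curve which near one of its points is a finite union of rays from that point
consists there of exactly two rays. -/
theorem exists_isLocallyTwoRays {f : AddCircle (1 : ℝ) → E} (hf : Continuous f)
    (hinj : Function.Injective f) (τ : AddCircle (1 : ℝ)) {D : Set E} (hfin : D.Finite)
    (hnorm : ∀ u ∈ D, ‖u‖ = 1)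
    (hD : ∀ᶠ x in 𝓝 (f τ), (x ∈ range f ∧ x ≠ f τ ↔ ∃ u ∈ D, ∃ t : ℝ, 0 < t ∧ x = f τ + t • u)) :
    ∃ u v : E, ‖u‖ = 1 ∧ ‖v‖ = 1 ∧ u ≠ v ∧ IsLocallyTwoRays (range f) (f τ) u v := by
  set g : ℝ → E := fun s => f (τ + (s : AddCircle (1 : ℝ))) with hg
  have hgc : Continuous g := hf.comp (continuous_const.add (AddCircle.continuous_mk' 1))
  have hg₀ : g 0 = f τ := by simp [hg]
  obtain ⟨ε, hε, hε₁, hgD⟩ : ∃ ε > 0, ε ≤ 1 / 2 ∧ ∀ s ∈ Ioo (-ε) ε,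
      (g s ∈ range f ∧ g s ≠ f τ ↔ ∃ u ∈ D, ∃ t : ℝ, 0 < t ∧ g s = f τ + t • u) := by
    have htend : Filter.Tendsto g (𝓝 0) (𝓝 (f τ)) := hg₀ ▸ hgc.tendsto 0
    have := htend.eventually hD
    obtain ⟨ε, hε, h⟩ := Metric.eventually_nhds_iff.1 this
    refine ⟨min ε (1 / 2), by positivity, min_le_right _ _, fun s hs => h ?_⟩
    rw [Real.dist_eq, sub_zero, abs_lt]
    exact ⟨by linarith [hs.1, min_le_left ε (1 / 2)], by linarith [hs.2, min_le_left ε (1 / 2)]⟩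
  have hginj : InjOn g (Ioo (-ε) ε) := by
    intro s hs t ht hst
    have := add_left_cancel (hinj hst)
    exact (AddCircle.coe_eq_coe_iff_of_mem_Ico (p := (1 : ℝ)) (a := -(1 / 2))
      ⟨by linarith [hs.1], by linarith [hs.2]⟩ ⟨by linarith [ht.1], by linarith [ht.2]⟩).1 this
  have hne : ∀ s ∈ Ioo (-ε) ε, s ≠ 0 → g s ≠ f τ := fun s hs hs₀ h =>
    hs₀ (hginj hs ⟨by linarith, hε⟩ (h.trans hg₀.symm))
  set dir : ℝ → E := fun s => ‖g s - f τ‖⁻¹ • (g s - f τ) with hdir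
  have hpos : ∀ s ∈ Ioo (-ε) ε, s ≠ 0 → 0 < ‖g s - f τ‖ := fun s hs hs₀ =>
    norm_pos_iff.2 (sub_ne_zero.2 (hne s hs hs₀))
  have hdirD : ∀ s ∈ Ioo (-ε) ε, s ≠ 0 → dir s ∈ D := by
    intro s hs hs₀
    obtain ⟨u, hu, t, ht, h⟩ := (hgD s hs).1 ⟨mem_range_self _, hne s hs hs₀⟩
    have : dir s = u := by
      simp only [hdir]
      rw [h, add_sub_cancel_left, norm_smul, hnorm u hu, mul_one, Real.norm_eq_abs, abs_of_pos ht,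
        smul_smul, inv_mul_cancel₀ ht.ne', one_smul]
    exact this ▸ hu
  have hgdir : ∀ s ∈ Ioo (-ε) ε, s ≠ 0 → g s = f τ + ‖g s - f τ‖ • dir s := by
    intro s hs hs₀
    simp only [hdir]
    rw [smul_smul, mul_inv_cancel₀ (hpos s hs hs₀).ne', one_smul, add_sub_cancel]
  have hconst : ∀ I ⊆ Ioo (-ε) ε, IsPreconnected I → (0 : ℝ) ∉ I → ∀ s ∈ I, ∀ t ∈ I,
      dir s = dir t := by
    intro I hI hIc hI₀ s hs t ht
    have h₀ : ∀ s ∈ I, s ≠ 0 := fun s hs h => hI₀ (h ▸ hs)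
    have hcont : ContinuousOn dir I := by
      refine ContinuousOn.smul (ContinuousOn.inv₀ (by fun_prop) fun s hs => ?_) (by fun_prop)
      exact (hpos s (hI hs) (h₀ s hs)).ne'
    exact hfin.countable.isTotallyDisconnected (dir '' I)
      (image_subset_iff.2 fun s hs => hdirD s (hI hs) (h₀ s hs)) (hIc.image dir hcont)
      (mem_image_of_mem dir hs) (mem_image_of_mem dir ht)
  have hright : ∀ s ∈ Ioo 0 ε, dir s = dir (ε / 2) := fun s hs =>
    hconst (Ioo 0 ε) (Ioo_subset_Ioo_left (by linarith)) isPreconnected_Ioo (by simp) s hs _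
      ⟨by linarith, by linarith⟩
  have hleft : ∀ s ∈ Ioo (-ε) 0, dir s = dir (-(ε / 2)) := fun s hs =>
    hconst (Ioo (-ε) 0) (Ioo_subset_Ioo_right hε.le) isPreconnected_Ioo (by simp) s hs _
      ⟨by linarith, by linarith⟩
  have hmem₁ : ε / 2 ∈ Ioo (-ε) ε := ⟨by linarith, by linarith⟩
  have hmem₂ : -(ε / 2) ∈ Ioo (-ε) ε := ⟨by linarith, by linarith⟩
  have hD₁ := hdirD _ hmem₁ (by linarith)
  have hD₂ := hdirD _ hmem₂ (by linarith)
  refine ⟨dir (ε / 2), dir (-(ε / 2)), hnorm _ hD₁, hnorm _ hD₂, fun heq => ?_, ?_⟩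
  · have hray : ∀ s ∈ Ioo (-ε) ε, g s = f τ + ‖g s - f τ‖ • dir (ε / 2) := by
      intro s hs
      rcases lt_trichotomy s 0 with h | rfl | h
      · rw [heq, ← hleft s ⟨hs.1, h⟩]
        exact hgdir s hs h.ne
      · simp [hg₀]
      · rw [← hright s ⟨h, hs.2⟩]
        exact hgdir s hs h.ne'
    have hsub : Icc (-(ε / 2)) (ε / 2) ⊆ Ioo (-ε) ε :=
      Icc_subset_Ioo (by linarith) (by linarith)
    have hinjN : InjOn (fun s => ‖g s - f τ‖) (Icc (-(ε / 2)) (ε / 2)) := by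
      intro s hs t ht hst
      refine hginj (hsub hs) (hsub ht) ?_
      have hst : ‖g s - f τ‖ = ‖g t - f τ‖ := hst
      rw [hray s (hsub hs), hray t (hsub ht), hst]
    have h₁ := hpos _ hmem₁ (by linarith)
    have h₂ := hpos _ hmem₂ (by linarith)
    have hI₀ : (0 : ℝ) ∈ Icc (-(ε / 2)) (ε / 2) := ⟨by linarith, by linarith⟩
    have h₀ : ‖g 0 - f τ‖ = 0 := by simp [hg₀]
    rcases ContinuousOn.strictMonoOn_of_injOn_Icc' (by linarith) (by fun_prop) hinjN with h | h
    · have := h (left_mem_Icc.2 (by linarith)) hI₀ (by linarith)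
      dsimp only at this
      linarith
    · have := h hI₀ (right_mem_Icc.2 (by linarith)) (by linarith)
      dsimp only at this
      linarith
  · have hopen : IsOpenMap fun s : ℝ => τ + (s : AddCircle (1 : ℝ)) :=
      (Homeomorph.addLeft τ).isOpenMap.comp QuotientAddGroup.isOpenMap_coe
    have hnhds : (fun s : ℝ => τ + (s : AddCircle (1 : ℝ))) '' Ioo (-ε) ε ∈ 𝓝 τ :=
      (hopen _ isOpen_Ioo).mem_nhds ⟨0, ⟨by linarith, hε⟩, by simp⟩
    rw [(hf.isClosedEmbedding hinj).isInducing.nhds_eq_comap, Filter.mem_comap] at hnhds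
    obtain ⟨V, hV, hVsub⟩ := hnhds
    filter_upwards [hD, hV] with x hxD hxV
    constructor
    · rintro ⟨σ, rfl⟩
      obtain ⟨s, hs, rfl⟩ := hVsub hxV
      change ∃ t : ℝ, 0 ≤ t ∧ (g s = _ ∨ g s = _)
      rcases lt_trichotomy s 0 with h | rfl | h
      · refine ⟨‖g s - f τ‖, norm_nonneg _, .inr ?_⟩
        rw [← hleft s ⟨hs.1, h⟩]
        exact hgdir s hs h.ne
      · exact ⟨0, le_rfl, by simp [hg₀]⟩
      · refine ⟨‖g s - f τ‖, norm_nonneg _, .inl ?_⟩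
        rw [← hright s ⟨h, hs.2⟩]
        exact hgdir s hs h.ne'
    · rintro ⟨t, ht, hx⟩
      rcases ht.eq_or_lt with rfl | ht
      · rcases hx with rfl | rfl <;> simp
      · rcases hx with hx | hx
        · exact (hxD.2 ⟨_, hD₁, t, ht, hx⟩).1
        · exact (hxD.2 ⟨_, hD₂, t, ht, hx⟩).1

theorem IsLocallyTwoRays.eq_neg_of_mem (h : IsLocallyTwoRays Γ P u v) (hu : ‖u‖ = 1)
    (hv : ‖v‖ = 1) {e : E} (he : e ≠ 0) (h₁ : ∀ᶠ s in 𝓝[>] (0 : ℝ), P + s • e ∈ Γ)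
    (h₂ : ∀ᶠ s in 𝓝[>] (0 : ℝ), P - s • e ∈ Γ) : v = -u ∧ ∃ c : ℝ, c ≠ 0 ∧ e = c • u := by
  have h₃ := (tendsto_add_smul_nhdsGT P e).eventually h
  have h₄ := (tendsto_add_smul_nhdsGT P (-e)).eventually h
  obtain ⟨s, hs₁, hs₂, hs₃, hs₄, hs⟩ :=
    (h₁.and (h₂.and (h₃.and (h₄.and self_mem_nhdsWithin)))).exists
  have hs : 0 < s := hs
  rw [sub_eq_add_neg, ← smul_neg] at hs₂
  obtain ⟨t, ht, htx⟩ := hs₃.1 hs₁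
  obtain ⟨t', ht', htx'⟩ := hs₄.1 hs₂
  simp only [add_right_inj, smul_neg] at htx htx'
  have hse : s • e ≠ 0 := smul_ne_zero hs.ne' he
  have hsame : ∀ w : E, ‖w‖ = 1 → s • e = t • w → -(s • e) = t' • w → False := by
    intro w hw h₁ h₂
    have h₃ : (t + t') • w = 0 := by rw [add_smul, ← h₁, ← h₂, add_neg_cancel]
    have hw₀ : w ≠ 0 := by
      rintro rfl
      simp at hw
    have h₄ : t + t' = 0 := (smul_eq_zero.1 h₃).resolve_right hw₀
    have h₅ : t = 0 := by linarith
    exact hse (by rw [h₁, h₅, zero_smul])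
  have hopp : ∀ w w' : E, ‖w‖ = 1 → ‖w'‖ = 1 → s • e = t • w → -(s • e) = t' • w' →
      w' = -w ∧ ∃ c : ℝ, c ≠ 0 ∧ e = c • w := by
    intro w w' hw hw' h₁ h₂
    have htt : t = t' := by
      have h₃ := congrArg norm h₁
      have h₄ := congrArg norm h₂
      rw [norm_smul t, hw, mul_one, Real.norm_of_nonneg ht] at h₃
      rw [norm_neg, norm_smul t', hw', mul_one, Real.norm_of_nonneg ht'] at h₄
      exact h₃.symm.trans h₄
    have ht₀ : t ≠ 0 := by
      rintro rfl
      exact hse (by rw [h₁, zero_smul])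
    subst htt
    refine ⟨smul_right_injective E ht₀ ?_, s⁻¹ * t, by positivity, ?_⟩
    · change t • w' = t • (-w)
      rw [smul_neg, ← h₁, h₂]
    · rw [mul_smul, ← h₁, inv_smul_smul₀ hs.ne']
  rcases htx with h₁ | h₁ <;> rcases htx' with h₂ | h₂
  · exact (hsame u hu h₁ h₂).elim
  · exact hopp u v hu hv h₁ h₂
  · obtain ⟨h₃, c, hc, hec⟩ := hopp v u hv hu h₁ h₂
    exact ⟨by rw [h₃, neg_neg], -c, neg_ne_zero.2 hc, by rw [h₃, neg_smul_neg]; exact hec⟩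
  · exact (hsame v hv h₁ h₂).elim

end Polygon

section Crossing

open Topology Metric

/-- If membership in `c` changes exactly at the points of `B`, then it changes an even number of
times between two points of the same status. -/
theorem mem_iff_mem_iff_even_card {c : Set ℝ} {a : ℝ} (B : Finset ℝ) {b : ℝ} (hab : a ≤ b)
    (hB : ∀ t ∈ B, a < t ∧ t < b)
    (hconst : ∀ t ∈ Icc a b, t ∉ B → ∀ᶠ s in 𝓝 t, (s ∈ c ↔ t ∈ c))
    (hflip : ∀ t ∈ B, ∀ᶠ h in 𝓝[>] (0 : ℝ), ¬ (t - h ∈ c ↔ t + h ∈ c)) :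
    (a ∈ c ↔ b ∈ c) ↔ Even B.card := by
  induction B using Finset.induction_on_max generalizing b with
  | empty =>
    have : a ∈ c ↔ b ∈ c := isPreconnected_Icc.mem_iff_mem_of_eventually
      (fun t ht => (hconst t ht (by simp)).filter_mono nhdsWithin_le_nhds)
      (left_mem_Icc.2 hab) (right_mem_Icc.2 hab)
    simp [this]
  | insert t₀ B hmax ih =>
    have hsmall : ∀ {r : ℝ}, 0 < r → ∀ᶠ h in 𝓝[>] (0 : ℝ), h < r := fun hr =>
      (eventually_lt_nhds hr).filter_mono nhdsWithin_le_nhds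
    have ht₀ := hB t₀ (Finset.mem_insert_self _ _)
    obtain ⟨h, h₁, h₂, h₃, h₄, h₀⟩ := ((hflip t₀ (Finset.mem_insert_self _ _)).and
      ((hsmall (sub_pos.2 ht₀.1)).and ((hsmall (sub_pos.2 ht₀.2)).and
      (((Filter.eventually_all_finset B).2 fun t ht => hsmall (sub_pos.2 (hmax t ht))).and
      self_mem_nhdsWithin)))).exists
    have h₀ : 0 < h := h₀
    have hleft : (a ∈ c ↔ t₀ - h ∈ c) ↔ Even B.card := by
      refine ih (by linarith) (fun t ht => ⟨(hB t (Finset.mem_insert_of_mem ht)).1, ?_⟩)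
        (fun t ht htB => hconst t ⟨ht.1, by linarith [ht.2]⟩ ?_)
        fun t ht => hflip t (Finset.mem_insert_of_mem ht)
      · linarith [h₄ t ht]
      · rw [Finset.mem_insert, not_or]
        exact ⟨by linarith [ht.2], htB⟩
    have hright : t₀ + h ∈ c ↔ b ∈ c := by
      have hle : t₀ + h ≤ b := by linarith
      refine isPreconnected_Icc.mem_iff_mem_of_eventually (fun t ht => ?_)
        (left_mem_Icc.2 hle) (right_mem_Icc.2 hle)
      refine (hconst t ⟨by linarith [ht.1], ht.2⟩ ?_).filter_mono nhdsWithin_le_nhds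
      rw [Finset.mem_insert, not_or]
      exact ⟨by linarith [ht.1], fun htB => by linarith [hmax t htB, ht.1]⟩
    rw [Finset.card_insert_of_notMem fun hmem => lt_irrefl _ (hmax t₀ hmem), Nat.even_add_one,
      ← hleft]
    tauto

variable {E : Type*} [NormedAddCommGroup E] [NormedSpace ℝ E] {Γ : Set E}

theorem connectedComponentIn_compl_eq_of_not_isBounded (hE : 1 < Module.rank ℝ E)
    (hΓ : Bornology.IsBounded Γ) {x y : E}
    (hx : ¬ Bornology.IsBounded (connectedComponentIn Γᶜ x))
    (hy : ¬ Bornology.IsBounded (connectedComponentIn Γᶜ y)) :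
    connectedComponentIn Γᶜ x = connectedComponentIn Γᶜ y := by
  obtain ⟨r, hr, hΓr⟩ := hΓ.subset_closedBall_lt 0 0
  have hfar : ∀ {z : E}, ¬ Bornology.IsBounded (connectedComponentIn Γᶜ z) →
      ∃ w ∈ connectedComponentIn Γᶜ z, r < ‖w‖ := by
    intro z hz
    by_contra! hcon
    exact hz (isBounded_closedBall.subset fun w hw => mem_closedBall_zero_iff.2 (hcon w hw))
  obtain ⟨x', hx', hxr⟩ := hfar hx
  obtain ⟨y', hy', hyr⟩ := hfar hy
  have hconn : IsPreconnected {z : E | r < ‖z‖} := by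
    have himage : {z : E | r < ‖z‖} = (fun p : ℝ × E => p.1 • p.2) '' (Ioi r ×ˢ sphere 0 1) := by
      ext z
      simp only [mem_ofPred_eq, mem_image, mem_prod, mem_Ioi, mem_sphere_zero_iff_norm, Prod.exists]
      constructor
      · intro hz
        have hz₀ : ‖z‖ ≠ 0 := by linarith
        exact ⟨‖z‖, ‖z‖⁻¹ • z, ⟨hz, by rw [norm_smul, norm_inv, norm_norm, inv_mul_cancel₀ hz₀]⟩,
          by rw [smul_inv_smul₀ hz₀]⟩
      · rintro ⟨t, w, ⟨ht, hw⟩, rfl⟩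
        rw [norm_smul, hw, mul_one, Real.norm_of_nonneg (by linarith)]
        exact ht
    rw [himage]
    exact (isPreconnected_Ioi.prod (isPreconnected_sphere hE 0 1)).image _
      (continuous_fst.smul continuous_snd).continuousOn
  rw [connectedComponentIn_eq hx', connectedComponentIn_eq hy']
  have hsub : {z : E | r < ‖z‖} ⊆ Γᶜ := fun z hz hzΓ =>
    (mem_closedBall_zero_iff.1 (hΓr hzΓ)).not_gt hz
  exact connectedComponentIn_eq (hconn.subset_connectedComponentIn hxr hsub hyr)

end Crossing

section Jordan

open Topology

variable {E : Type*} [NormedAddCommGroup E] [NormedSpace ℝ E] {Γ : Set E}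

theorem eventually_mem_segment {a b P : E} (hP : P ∈ segment ℝ a b) (ha : P ≠ a) (hb : P ≠ b) :
    ∀ᶠ s in 𝓝[>] (0 : ℝ), P + s • (b - a) ∈ segment ℝ a b ∧ P - s • (b - a) ∈ segment ℝ a b := by
  rw [segment_eq_image'] at *
  obtain ⟨θ, ⟨hθ₀, hθ₁⟩, rfl⟩ := hP
  have hθ₀ : 0 < θ := hθ₀.lt_of_ne (by rintro rfl; simp at ha)
  have hθ₁ : θ < 1 := hθ₁.lt_of_ne (by rintro rfl; simp at hb)
  filter_upwards [Ioo_mem_nhdsGT hθ₀, Ioo_mem_nhdsGT (sub_pos.2 hθ₁)] with s h₁ h₂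
  exact ⟨⟨θ + s, ⟨by linarith [h₁.1], by linarith [h₂.2]⟩, by module⟩,
    ⟨θ - s, ⟨by linarith [h₁.2], by linarith [h₁.1]⟩, by module⟩⟩

/-- A segment which crosses `Γ` finitely often, each time through the relative interior of a
segment contained in `Γ`, crosses it an even number of times if and only if its end points lie on
the same side of `Γ`. -/
theorem mem_iff_mem_iff_even_ncard (hE : Module.finrank ℝ E = 2)
    (hrays : ∀ P ∈ Γ, ∃ u v : E, ‖u‖ = 1 ∧ ‖v‖ = 1 ∧ u ≠ v ∧ IsLocallyTwoRays Γ P u v)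
    {χ : Set E} (hχ : ∀ R, SeparatesAt Γ χ R) {S T : E} (hS : S ∉ Γ) (hT : T ∉ Γ)
    (hfin : (segment ℝ S T ∩ Γ).Finite)
    (hcross : ∀ P ∈ segment ℝ S T ∩ Γ, ∃ a b : E, P ∈ segment ℝ a b ∧ segment ℝ a b ⊆ Γ ∧
      P ≠ a ∧ P ≠ b ∧ LinearIndependent ℝ ![T - S, b - a]) :
    (S ∈ χ ↔ T ∈ χ) ↔ Even (segment ℝ S T ∩ Γ).ncard := by
  rcases eq_or_ne S T with rfl | hST
  · have : segment ℝ S S ∩ Γ = ∅ := by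
      rw [segment_same, singleton_inter_eq_empty]
      exact hS
    rw [this]
    simp
  set γ : ℝ → E := fun t => S + t • (T - S) with hγ
  have hγc : Continuous γ := by fun_prop
  have hγinj : Function.Injective γ := fun s t hst =>
    smul_left_injective ℝ (sub_ne_zero.2 hST.symm) (add_left_cancel hst)
  have hγ₀ : γ 0 = S := by simp [hγ]
  have hγ₁ : γ 1 = T := by simp [hγ]
  have himage : segment ℝ S T ∩ Γ = γ '' (Icc 0 1 ∩ γ ⁻¹' Γ) := by
    rw [image_inter_preimage, segment_eq_image']
  have hBfin : (Icc 0 1 ∩ γ ⁻¹' Γ).Finite := (himage ▸ hfin).of_finite_image hγinj.injOn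
  have hmem : ∀ t, t ∈ hBfin.toFinset ↔ t ∈ Icc (0 : ℝ) 1 ∧ γ t ∈ Γ := fun t => by simp
  rw [himage, ncard_image_of_injective _ hγinj, ncard_eq_toFinset_card _ hBfin]
  have key := mem_iff_mem_iff_even_card (c := γ ⁻¹' χ) (a := 0) hBfin.toFinset zero_le_one
    (fun t ht => ?_) (fun t ht htB => ?_) (fun t ht => ?_)
  · rwa [mem_preimage, mem_preimage, hγ₀, hγ₁] at key
  · obtain ⟨⟨h₀, h₁⟩, htΓ⟩ := (hmem t).1 ht
    refine ⟨h₀.lt_of_ne ?_, h₁.lt_of_ne ?_⟩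
    · rintro rfl
      exact hS (hγ₀ ▸ htΓ)
    · rintro rfl
      exact hT (hγ₁ ▸ htΓ)
  · exact (hγc.tendsto t).eventually ((hχ (γ t)).1 fun h => htB ((hmem t).2 ⟨ht, h⟩))
  · have hP := (hmem t).1 ht
    obtain ⟨a, b, hab, habΓ, ha, hb, hli⟩ := hcross (γ t) (himage ▸ mem_image_of_mem γ hP)
    obtain ⟨u, w, hu, hw, -, htwo⟩ := hrays (γ t) hP.2
    have hseg := eventually_mem_segment hab ha hb
    obtain ⟨rfl, c, hc, hcu⟩ := htwo.eq_neg_of_mem hu hw (hli.ne_zero 1)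
      (hseg.mono fun s hs => habΓ hs.1) (hseg.mono fun s hs => habΓ hs.2)
    have hli' : LinearIndependent ℝ ![u, T - S] := by
      rw [LinearIndependent.pair_iff] at hli ⊢
      intro p q hpq
      have hpq' : q • (T - S) + (p * c⁻¹) • (b - a) = 0 := by
        simp only [Matrix.cons_val_one, Matrix.cons_val_zero] at hcu
        rw [hcu, smul_smul, mul_assoc, inv_mul_cancel₀ hc, mul_one, add_comm, hpq]
      obtain ⟨h₁, h₂⟩ := hli _ _ hpq'
      exact ⟨(mul_eq_zero.1 h₂).resolve_right (inv_ne_zero hc), h₁⟩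
    filter_upwards [htwo.eventually_not_iff hE hli' hP.2 hχ] with h hh
    have h₁ : γ (t - h) = γ t - h • (T - S) := by
      simp only [hγ]
      module
    have h₂ : γ (t + h) = γ t + h • (T - S) := by
      simp only [hγ]
      module
    rwa [mem_preimage, mem_preimage, h₁, h₂]

end Jordan

/-- Jordan's parity lemma for a simple closed polygon: if `S` is exterior to the polygon
`Γ` with vertices `v 0, …, v (m-1)`, `T ∉ Γ`, and the segment `[S, T]` meets `Γ` in a
finite set `F` containing no vertex of `Γ` and crossing every edge it meets non-parallelly,
then `T` lies in the interior of `Γ` if and only if `F` has odd cardinality. -/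
theorem jordan_parity_lemma
    (m : ℕ) (v : ℕ → Plane) (Γ : Set Plane)
    (hΓ : Γ = ⋃ k ∈ Finset.range m, segment ℝ (v k) (v ((k + 1) % m)))
    (hJ : IsJordanCurve Γ)
    (S T : Plane) (hS : IsExteriorTo S Γ) (hT : T ∉ Γ)
    (F : Set Plane) (hF : F = segment ℝ S T ∩ Γ) (hfin : F.Finite)
    (hvert : ∀ P ∈ F, ∀ k < m, P ≠ v k)
    (hpar : ∀ P ∈ F, ∀ k < m, P ∈ segment ℝ (v k) (v ((k + 1) % m)) →
      LinearIndependent ℝ ![T - S, v ((k + 1) % m) - v k]) :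
    T ∈ curveInterior Γ ↔ Odd F.ncard := by
  obtain ⟨f, hf, hinj, hrange⟩ := hJ
  have hE : Module.finrank ℝ Plane = 2 := finrank_euclideanSpace_fin
  have hcompact : IsCompact Γ := hrange ▸ isCompact_range hf
  have hrays : ∀ P ∈ Γ, ∃ u w : Plane, ‖u‖ = 1 ∧ ‖w‖ = 1 ∧ u ≠ w ∧ IsLocallyTwoRays Γ P u w := by
    intro P hP
    obtain ⟨τ, rfl⟩ := hrange ▸ hP
    obtain ⟨D, hDfin, hDnorm, hD⟩ := exists_directions_iUnion_segment (Finset.range m) v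
      (fun k => v ((k + 1) % m)) (f τ)
    rw [← hΓ, ← hrange] at hD
    rw [← hrange]
    exact exists_isLocallyTwoRays hf hinj τ hDfin hDnorm hD
  have hsides := locallyTwoSided_of_isLocallyTwoRays hE hrays
  obtain ⟨χ, hχ⟩ := hsides.exists_separatesAt hcompact.isClosed
  have hcomp := hsides.connectedComponentIn_eq_iff hcompact.isClosed
    (hrange ▸ range_nonempty f) (hrange ▸ isPreconnected_range hf) hχ hS.1 hT
  have hint : T ∈ curveInterior Γ ↔ ¬ (S ∈ χ ↔ T ∈ χ) := by
    rw [← hcomp]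
    refine ⟨fun h heq => hS.2 (heq ▸ h.2), fun hne => ⟨hT, ?_⟩⟩
    by_contra hunb
    refine hne (connectedComponentIn_compl_eq_of_not_isBounded ?_ hcompact.isBounded hS.2 hunb)
    exact Module.lt_rank_of_lt_finrank (by rw [hE]; norm_num)
  subst hF
  rw [hint, mem_iff_mem_iff_even_ncard hE hrays hχ hS.1 hT hfin ?_, Nat.not_even_iff_odd]
  intro P hP
  have hPΓ := hP.2
  rw [hΓ] at hPΓ
  simp only [mem_iUnion, Finset.mem_range, exists_prop] at hPΓ
  obtain ⟨k, hk, hPk⟩ := hPΓ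
  refine ⟨_, _, hPk, ?_, hvert P hP k hk, hvert P hP _ (Nat.mod_lt _ (by omega)),
    hpar P hP k hk hPk⟩
  rw [hΓ]
  exact subset_biUnion_of_mem (u := fun k => segment ℝ (v k) (v ((k + 1) % m)))
    (Finset.mem_coe.2 (Finset.mem_range.2 hk))
end
end
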